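/- arXiv:1506.03306 — 3 statements merged into one kernel-verified Lean document; each statement's English description precedes it below -/
import Mathlib

section
/- Every K₄-free simple graph G on n vertices with at least n²/4 + k edges (i.e., with 4·|E(G)| ≥ n² + 4k, where k is a natural number) contains k pairwise edge-disjoint triangles, i.e., there exists a family of k triangles of G no two of which share an edge. -/
namespace SimpleGraph

set_option linter.unusedSectionVars false

variable {V : Type*} [DecidableEq V] (G : SimpleGraph V) [DecidableRel G.Adj]

/-- The adjacency indicator of `G`, as an integer. -/
def adjInt (u v : V) : ℤ := if G.Adj u v then 1 else 0

/-- The number of adjacent pairs in `P × Q`. -/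
def edgesAcross (P Q : Finset V) : ℤ := ∑ u ∈ P, ∑ v ∈ Q, G.adjInt u v

/-- The number of pairwise adjacent triples in `P × Q × R`. -/
def trianglesAcross (P Q R : Finset V) : ℤ :=
  ∑ u ∈ P, ∑ v ∈ Q, ∑ w ∈ R, G.adjInt u v * G.adjInt u w * G.adjInt v w

/-- The number of edges between two cliques, compared with the value for which a partition into
`r` cliques of `n` vertices has about `r (n - r)` edges. -/
def excess (P Q : Finset V) : ℤ := G.edgesAcross P Q - P.card - Q.card + 2

/-- The number of transversal triangles of three cliques minus the total excess. -/
def surplus (P Q R : Finset V) : ℤ :=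
  G.trianglesAcross P Q R - G.excess P Q - G.excess P R - G.excess Q R

variable {G}

theorem adjInt_comm (u v : V) : G.adjInt u v = G.adjInt v u := by
  simp [adjInt, G.adj_comm]

theorem adjInt_self (u : V) : G.adjInt u u = 0 := by simp [adjInt]

theorem adjInt_eq_zero_or_one (u v : V) : G.adjInt u v = 0 ∨ G.adjInt u v = 1 := by
  unfold adjInt; split_ifs <;> simp

theorem adjInt_nonneg (u v : V) : 0 ≤ G.adjInt u v := by
  unfold adjInt; split_ifs <;> simp

theorem adjInt_le_one (u v : V) : G.adjInt u v ≤ 1 := by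
  unfold adjInt; split_ifs <;> simp

theorem adjInt_eq_one {u v : V} (h : G.Adj u v) : G.adjInt u v = 1 := by simp [adjInt, h]

theorem adj_of_adjInt {u v : V} (h : G.adjInt u v = 1) : G.Adj u v := by
  by_contra h'; simp [adjInt, h'] at h

theorem adjInt_eq_toNat (u v : V) : G.adjInt u v = ((decide (G.Adj u v)).toNat : ℤ) := by
  by_cases h : G.Adj u v <;> simp [adjInt, h]

theorem not_adj_of_cliqueFree_four (hK : G.CliqueFree 4) {a b c d : V} (hab : G.Adj a b)
    (hac : G.Adj a c) (had : G.Adj a d) (hbc : G.Adj b c) (hbd : G.Adj b d) :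
    ¬ G.Adj c d := by
  intro hcd
  apply hK {a, b, c, d}
  rw [isNClique_iff]
  constructor
  · intro x hx y hy hxy
    simp only [Finset.coe_insert, Finset.coe_singleton, Set.mem_insert_iff,
      Set.mem_singleton_iff] at hx hy
    rcases hx with rfl | rfl | rfl | rfl <;> rcases hy with rfl | rfl | rfl | rfl <;>
      first | exact absurd rfl hxy | assumption | (apply Adj.symm; assumption)
  · rw [Finset.card_insert_of_notMem, Finset.card_insert_of_notMem, Finset.card_pair hcd.ne] <;>
      simp [hab.ne, hac.ne, had.ne, hbc.ne, hbd.ne]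

theorem sum_adjInt_le_five (hK : G.CliqueFree 4) (a b c d : V) :
    G.adjInt a b + G.adjInt a c + G.adjInt a d + G.adjInt b c + G.adjInt b d + G.adjInt c d
      ≤ 5 := by
  by_contra! h
  have h1 := G.adjInt_le_one a b
  have h2 := G.adjInt_le_one a c
  have h3 := G.adjInt_le_one a d
  have h4 := G.adjInt_le_one b c
  have h5 := G.adjInt_le_one b d
  have h6 := G.adjInt_le_one c d
  have h1' : G.adjInt a b = 1 := by lia
  have h2' : G.adjInt a c = 1 := by lia
  have h3' : G.adjInt a d = 1 := by lia
  have h4' : G.adjInt b c = 1 := by lia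
  have h5' : G.adjInt b d = 1 := by lia
  have h6' : G.adjInt c d = 1 := by lia
  exact not_adj_of_cliqueFree_four hK (adj_of_adjInt h1') (adj_of_adjInt h2') (adj_of_adjInt h3')
    (adj_of_adjInt h4') (adj_of_adjInt h5') (adj_of_adjInt h6')

theorem edgesAcross_comm (P Q : Finset V) : G.edgesAcross P Q = G.edgesAcross Q P := by
  unfold edgesAcross
  rw [Finset.sum_comm]
  simp only [adjInt_comm]

theorem excess_comm (P Q : Finset V) : G.excess P Q = G.excess Q P := by
  unfold excess
  rw [edgesAcross_comm]; ring

theorem trianglesAcross_swap_left (P Q R : Finset V) :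
    G.trianglesAcross P Q R = G.trianglesAcross Q P R := by
  unfold trianglesAcross
  rw [Finset.sum_comm]
  refine Finset.sum_congr rfl fun u _ => Finset.sum_congr rfl fun v _ =>
    Finset.sum_congr rfl fun w _ => ?_
  rw [adjInt_comm v u]; ring

theorem trianglesAcross_swap_right (P Q R : Finset V) :
    G.trianglesAcross P Q R = G.trianglesAcross P R Q := by
  unfold trianglesAcross
  refine Finset.sum_congr rfl fun u _ => ?_
  rw [Finset.sum_comm]
  refine Finset.sum_congr rfl fun v _ => Finset.sum_congr rfl fun w _ => ?_
  rw [adjInt_comm v w]; ring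

theorem surplus_swap_left (P Q R : Finset V) : G.surplus P Q R = G.surplus Q P R := by
  unfold surplus
  rw [trianglesAcross_swap_left, excess_comm P Q]; ring

theorem surplus_swap_right (P Q R : Finset V) : G.surplus P Q R = G.surplus P R Q := by
  unfold surplus
  rw [trianglesAcross_swap_right, excess_comm Q R]; ring

theorem surplus_rotate (P Q R : Finset V) : G.surplus P Q R = G.surplus Q R P := by
  rw [surplus_swap_left, surplus_swap_right]

theorem trianglesAcross_nonneg (P Q R : Finset V) : 0 ≤ G.trianglesAcross P Q R :=
  Finset.sum_nonneg fun _ _ => Finset.sum_nonneg fun _ _ => Finset.sum_nonneg fun _ _ =>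
    mul_nonneg (mul_nonneg (adjInt_nonneg _ _) (adjInt_nonneg _ _)) (adjInt_nonneg _ _)

/-- Expansion of the surplus along the vertices of its third argument. -/
theorem surplus_eq_sum (P Q R : Finset V) :
    G.surplus P Q R = ∑ w ∈ R, G.surplus P Q {w} +
      (R.card - 1) * (G.excess P Q - P.card - Q.card + 4) := by
  have h1 : G.trianglesAcross P Q R = ∑ w ∈ R, G.trianglesAcross P Q {w} := by
    unfold trianglesAcross
    simp only [Finset.sum_singleton]
    rw [Finset.sum_comm (s := R)]
    exact Finset.sum_congr rfl fun u _ => Finset.sum_comm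
  have h2 (S : Finset V) : G.edgesAcross S R = ∑ w ∈ R, G.edgesAcross S {w} := by
    unfold edgesAcross
    simp only [Finset.sum_singleton]
    exact Finset.sum_comm
  unfold surplus excess
  rw [h1, h2 P, h2 Q]
  simp only [Finset.sum_add_distrib, Finset.sum_sub_distrib, Finset.sum_const,
    Finset.card_singleton]
  simp only [nsmul_eq_mul]
  push_cast
  ring

/-- Three pairwise adjacent vertices listing the triangle `T`. -/
structure Lists (G : SimpleGraph V) (T : Finset V) (a : Fin 3 → V) : Prop where
  adj : ∀ i j, i ≠ j → G.Adj (a i) (a j)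
  sum_eq : ∀ f : V → ℤ, ∑ x ∈ T, f x = ∑ i, f (a i)
  card_eq : T.card = 3

theorem IsNClique.exists_lists {T : Finset V} (hT : G.IsNClique 3 T) :
    ∃ a, Lists G T a := by
  obtain ⟨a, b, c, hab, hac, hbc, rfl⟩ := is3Clique_iff.1 hT
  refine ⟨![a, b, c], ?_, ?_, hT.card_eq⟩
  · intro i j hij
    fin_cases i <;> fin_cases j <;> simp_all [G.adj_comm]
  · intro f
    rw [Finset.sum_insert (by simp [hab.ne, hac.ne]), Finset.sum_pair hbc.ne, Fin.sum_univ_three]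
    simp [add_assoc]

theorem Lists.comp {T : Finset V} {a : Fin 3 → V} (h : Lists G T a) (π : Equiv.Perm (Fin 3)) :
    Lists G T (a ∘ π) :=
  ⟨fun i j hij => h.adj _ _ (π.injective.ne hij),
    fun f => by rw [h.sum_eq]; exact (Equiv.sum_comp π fun i => f (a i)).symm, h.card_eq⟩

theorem IsNClique.exists_pair {Q : Finset V} (hQ : G.IsNClique 2 Q) :
    ∃ u v, G.Adj u v ∧ Q = {u, v} := by
  obtain ⟨u, v, huv, rfl⟩ := Finset.card_eq_two.1 hQ.card_eq
  exact ⟨u, v, hQ.isClique (by simp) (by simp) huv, rfl⟩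

theorem sum_adjInt_triangle_le_two (hK : G.CliqueFree 4) {T : Finset V} {a : Fin 3 → V}
    (h : Lists G T a) (s : V) :
    G.adjInt (a 0) s + G.adjInt (a 1) s + G.adjInt (a 2) s ≤ 2 := by
  have := sum_adjInt_le_five hK (a 0) (a 1) (a 2) s
  rw [adjInt_eq_one (h.adj 0 1 (by decide)), adjInt_eq_one (h.adj 0 2 (by decide)),
    adjInt_eq_one (h.adj 1 2 (by decide))] at this
  lia

theorem excess_triangle_singleton (hK : G.CliqueFree 4) {T : Finset V} (hT : G.IsNClique 3 T)
    (s : V) : G.excess T {s} ≤ 0 := by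
  obtain ⟨a, ha⟩ := hT.exists_lists
  have := sum_adjInt_triangle_le_two hK ha s
  simp only [excess, edgesAcross, Finset.sum_singleton, ha.sum_eq, Fin.sum_univ_three, ha.card_eq,
    Finset.card_singleton]
  push_cast
  lia

theorem transversal_bound_three (e11 e12 e13 e21 e22 e23 e31 e32 e33 s1 s2 s3 r1 r2 r3 : ℤ)
    (h11 : 0 ≤ e11 ∧ e11 ≤ 1) (h12 : 0 ≤ e12 ∧ e12 ≤ 1) (h13 : 0 ≤ e13 ∧ e13 ≤ 1)
    (h21 : 0 ≤ e21 ∧ e21 ≤ 1) (h22 : 0 ≤ e22 ∧ e22 ≤ 1) (h23 : 0 ≤ e23 ∧ e23 ≤ 1)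
    (h31 : 0 ≤ e31 ∧ e31 ≤ 1) (h32 : 0 ≤ e32 ∧ e32 ≤ 1) (h33 : 0 ≤ e33 ∧ e33 ≤ 1)
    (hs1 : s1 = 0 ∨ s1 = 1) (hs2 : s2 = 0 ∨ s2 = 1) (hs3 : s3 = 0 ∨ s3 = 1)
    (hr1 : r1 = 0 ∨ r1 = 1) (hr2 : r2 = 0 ∨ r2 = 1) (hr3 : r3 = 0 ∨ r3 = 1)
    (a1 : e11 + e12 + e13 ≤ 2) (a2 : e21 + e22 + e23 ≤ 2) (a3 : e31 + e32 + e33 ≤ 2)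
    (b1 : e11 + e21 + e31 ≤ 2) (b2 : e12 + e22 + e32 ≤ 2) (b3 : e13 + e23 + e33 ≤ 2)
    (hs : s1 + s2 + s3 ≤ 2) (hr : r1 + r2 + r3 ≤ 2) :
    e11 + e12 + e13 + e21 + e22 + e23 + e31 + e32 + e33 + (s1 + s2 + s3) + (r1 + r2 + r3) - 8 ≤
      e11 * s1 * r1 + e12 * s1 * r2 + e13 * s1 * r3 +
        (e21 * s2 * r1 + e22 * s2 * r2 + e23 * s2 * r3)
      + (e31 * s3 * r1 + e32 * s3 * r2 + e33 * s3 * r3) := by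
  rcases hs1 with rfl | rfl <;> rcases hs2 with rfl | rfl <;> rcases hs3 with rfl | rfl <;>
  rcases hr1 with rfl | rfl <;> rcases hr2 with rfl | rfl <;> rcases hr3 with rfl | rfl <;> omega

theorem surplus_triangle_triangle_singleton (hK : G.CliqueFree 4) {T T' : Finset V}
    (hT : G.IsNClique 3 T) (hT' : G.IsNClique 3 T') (s : V) : 0 ≤ G.surplus T T' {s} := by
  obtain ⟨a, ha⟩ := hT.exists_lists
  obtain ⟨b, hb⟩ := hT'.exists_lists
  have hbound (i j) : 0 ≤ G.adjInt (a i) (b j) ∧ G.adjInt (a i) (b j) ≤ 1 :=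
    ⟨adjInt_nonneg _ _, adjInt_le_one _ _⟩
  have hrow (i) := sum_adjInt_triangle_le_two hK hb (a i)
  have hcol (j) := sum_adjInt_triangle_le_two hK ha (b j)
  simp only [fun i j => adjInt_comm (G := G) (b i) (a j)] at hrow
  have := transversal_bound_three _ _ _ _ _ _ _ _ _ _ _ _ _ _ _ (hbound 0 0) (hbound 0 1)
    (hbound 0 2) (hbound 1 0) (hbound 1 1) (hbound 1 2) (hbound 2 0) (hbound 2 1) (hbound 2 2)
    (adjInt_eq_zero_or_one (a 0) s) (adjInt_eq_zero_or_one (a 1) s)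
    (adjInt_eq_zero_or_one (a 2) s) (adjInt_eq_zero_or_one (b 0) s)
    (adjInt_eq_zero_or_one (b 1) s) (adjInt_eq_zero_or_one (b 2) s) (hrow 0) (hrow 1) (hrow 2)
    (hcol 0) (hcol 1) (hcol 2) (sum_adjInt_triangle_le_two hK ha s)
    (sum_adjInt_triangle_le_two hK hb s)
  simp only [surplus, trianglesAcross, excess, edgesAcross, Finset.sum_singleton, ha.sum_eq,
    hb.sum_eq, Fin.sum_univ_three, ha.card_eq, hb.card_eq, Finset.card_singleton]
  push_cast
  linarith

theorem transversal_bound_two (e11 e12 e21 e22 e31 e32 s1 s2 s3 r1 r2 : ℤ)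
    (h11 : e11 = 0 ∨ e11 = 1) (h12 : e12 = 0 ∨ e12 = 1) (h21 : e21 = 0 ∨ e21 = 1)
    (h22 : e22 = 0 ∨ e22 = 1) (h31 : e31 = 0 ∨ e31 = 1) (h32 : e32 = 0 ∨ e32 = 1)
    (hs1 : s1 = 0 ∨ s1 = 1) (hs2 : s2 = 0 ∨ s2 = 1) (hs3 : s3 = 0 ∨ s3 = 1)
    (hr1 : r1 = 0 ∨ r1 = 1) (hr2 : r2 = 0 ∨ r2 = 1)
    (b1 : e11 + e21 + e31 ≤ 2) (b2 : e12 + e22 + e32 ≤ 2) (hs : s1 + s2 + s3 ≤ 2)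
    (k1 : e11 + e12 + s1 + r1 + r2 ≤ 4) (k2 : e21 + e22 + s2 + r1 + r2 ≤ 4)
    (k3 : e31 + e32 + s3 + r1 + r2 ≤ 4)
    (l12 : e11 + e21 + s1 + s2 + r1 ≤ 4) (l13 : e11 + e31 + s1 + s3 + r1 ≤ 4)
    (l23 : e21 + e31 + s2 + s3 + r1 ≤ 4)
    (m12 : e12 + e22 + s1 + s2 + r2 ≤ 4) (m13 : e12 + e32 + s1 + s3 + r2 ≤ 4)
    (m23 : e22 + e32 + s2 + s3 + r2 ≤ 4)
    (n12 : e11 + e12 + e21 + e22 ≤ 3) (n13 : e11 + e12 + e31 + e32 ≤ 3)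
    (n23 : e21 + e22 + e31 + e32 ≤ 3) :
    e11 + e12 + e21 + e22 + e31 + e32 + (s1 + s2 + s3) + (r1 + r2) - 6 ≤
      e11 * s1 * r1 + e12 * s1 * r2 + (e21 * s2 * r1 + e22 * s2 * r2)
      + (e31 * s3 * r1 + e32 * s3 * r2) := by
  rcases hs1 with rfl | rfl <;> rcases hs2 with rfl | rfl <;> rcases hs3 with rfl | rfl <;>
  rcases hr1 with rfl | rfl <;> rcases hr2 with rfl | rfl <;> omega

theorem surplus_triangle_pair_singleton (hK : G.CliqueFree 4) {T Q : Finset V}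
    (hT : G.IsNClique 3 T) (hQ : G.IsNClique 2 Q) (s : V) : 0 ≤ G.surplus T Q {s} := by
  obtain ⟨a, ha⟩ := hT.exists_lists
  obtain ⟨u, v, huv, rfl⟩ := hQ.exists_pair
  have h01 := adjInt_eq_one (ha.adj 0 1 (by decide))
  have h02 := adjInt_eq_one (ha.adj 0 2 (by decide))
  have h12 := adjInt_eq_one (ha.adj 1 2 (by decide))
  have huv' := adjInt_eq_one huv
  have hk (i) := sum_adjInt_le_five hK (a i) u v s
  have hl (i j w) := sum_adjInt_le_five hK (a i) (a j) w s
  have hn (i j) := sum_adjInt_le_five hK (a i) (a j) u v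
  have := transversal_bound_two _ _ _ _ _ _ _ _ _ _ _ (adjInt_eq_zero_or_one (a 0) u)
    (adjInt_eq_zero_or_one (a 0) v) (adjInt_eq_zero_or_one (a 1) u)
    (adjInt_eq_zero_or_one (a 1) v) (adjInt_eq_zero_or_one (a 2) u)
    (adjInt_eq_zero_or_one (a 2) v) (adjInt_eq_zero_or_one (a 0) s)
    (adjInt_eq_zero_or_one (a 1) s) (adjInt_eq_zero_or_one (a 2) s)
    (adjInt_eq_zero_or_one u s) (adjInt_eq_zero_or_one v s)
    (sum_adjInt_triangle_le_two hK ha u) (sum_adjInt_triangle_le_two hK ha v)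
    (sum_adjInt_triangle_le_two hK ha s)
    (by linarith [hk 0]) (by linarith [hk 1]) (by linarith [hk 2])
    (by linarith [hl 0 1 u]) (by linarith [hl 0 2 u]) (by linarith [hl 1 2 u])
    (by linarith [hl 0 1 v]) (by linarith [hl 0 2 v]) (by linarith [hl 1 2 v])
    (by linarith [hn 0 1]) (by linarith [hn 0 2]) (by linarith [hn 1 2])
  simp only [surplus, trianglesAcross, excess, edgesAcross, Finset.sum_singleton, ha.sum_eq,
    Fin.sum_univ_three, ha.card_eq, hQ.card_eq, Finset.card_singleton, Finset.sum_pair huv.ne]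
  push_cast
  linarith

theorem surplus_eq_sum_of_triangles {T T' : Finset V} (hT : G.IsNClique 3 T)
    (hT' : G.IsNClique 3 T') (R : Finset V) :
    G.surplus T T' R = ∑ w ∈ R, G.surplus T T' {w} + (R.card - 1) * (G.excess T T' - 2) := by
  rw [surplus_eq_sum, hT.card_eq, hT'.card_eq]; push_cast; ring

theorem surplus_eq_sum_of_triangle_pair {T Q : Finset V} (hT : G.IsNClique 3 T)
    (hQ : G.IsNClique 2 Q) (R : Finset V) :
    G.surplus T Q R = ∑ w ∈ R, G.surplus T Q {w} + (R.card - 1) * (G.excess T Q - 1) := by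
  rw [surplus_eq_sum, hT.card_eq, hQ.card_eq]; push_cast; ring

theorem surplus_triangle_pair_pair (hK : G.CliqueFree 4) {T Q Q' : Finset V}
    (hT : G.IsNClique 3 T) (hQ : G.IsNClique 2 Q) (hQ' : G.IsNClique 2 Q')
    (hQQ' : G.excess Q Q' ≤ 0) : 0 ≤ G.surplus T Q Q' := by
  have h1 := surplus_eq_sum_of_triangle_pair hT hQ Q'
  have h2 := surplus_eq_sum_of_triangle_pair hT hQ' Q
  rw [surplus_swap_right] at h2
  have h3 := Finset.sum_nonneg fun w (_ : w ∈ Q') => surplus_triangle_pair_singleton hK hT hQ w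
  have h4 := Finset.sum_nonneg fun w (_ : w ∈ Q) => surplus_triangle_pair_singleton hK hT hQ' w
  have h5 := G.trianglesAcross_nonneg T Q Q'
  rw [hQ.card_eq] at h2
  rw [hQ'.card_eq] at h1
  push_cast at h1 h2
  by_contra! h
  have h6 : G.excess T Q ≤ 0 := by linarith
  have h7 : G.excess T Q' ≤ 0 := by linarith
  unfold surplus at h
  linarith

/-- A triple of two triangles and an edge can only have negative surplus in one way. -/
theorem surplus_triangle_triangle_pair (hK : G.CliqueFree 4) {T T' Q : Finset V}
    (hT : G.IsNClique 3 T) (hT' : G.IsNClique 3 T') (hQ : G.IsNClique 2 Q) :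
    0 ≤ G.surplus T T' Q ∨ G.surplus T T' Q = -1 ∧ G.excess T T' = 1 ∧ G.excess T Q = 0 ∧
      G.excess T' Q = 0 ∧ ∀ w ∈ Q, G.surplus T T' {w} = 0 := by
  have h1 := surplus_eq_sum_of_triangles hT hT' Q
  have h2 := surplus_eq_sum_of_triangle_pair hT hQ T'
  have h3 := surplus_eq_sum_of_triangle_pair hT' hQ T
  have h1' := fun w (_ : w ∈ Q) => surplus_triangle_triangle_singleton hK hT hT' w
  have h2' := Finset.sum_nonneg fun w (_ : w ∈ T') => surplus_triangle_pair_singleton hK hT hQ w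
  have h3' := Finset.sum_nonneg fun w (_ : w ∈ T) => surplus_triangle_pair_singleton hK hT' hQ w
  have h4 := Finset.sum_nonneg h1'
  rw [surplus_swap_right] at h2
  rw [← surplus_rotate] at h3
  have h5 := G.trianglesAcross_nonneg T T' Q
  rw [hQ.card_eq] at h1
  rw [hT'.card_eq] at h2
  rw [hT.card_eq] at h3
  push_cast at h1 h2 h3
  by_cases h : 0 ≤ G.surplus T T' Q
  · exact Or.inl h
  have h6 : G.excess T Q ≤ 0 := by linarith
  have h7 : G.excess T' Q ≤ 0 := by linarith
  have h8 : G.excess T T' ≤ 1 := by linarith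
  have h9 : G.surplus T T' Q = G.trianglesAcross T T' Q - G.excess T T' - G.excess T Q
    - G.excess T' Q := rfl
  have h10 : ∑ w ∈ Q, G.surplus T T' {w} = 0 := by linarith
  refine Or.inr ⟨by linarith, by linarith, by linarith, by linarith, ?_⟩
  exact (Finset.sum_eq_zero_iff_of_nonneg h1').1 h10

/-- The triangles listed by `a` and `b` are joined by the edges of the path
`a 0, b 0, a 1, b 1, a 2, b 2`. -/
structure PathLists (G : SimpleGraph V) (T T' : Finset V) (a b : Fin 3 → V) : Prop where
  left : Lists G T a
  right : Lists G T' b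
  adj_iff : ∀ i j, G.Adj (a i) (b j) ↔ j = i ∨ i.val = j.val + 1

set_option maxRecDepth 100000 in
theorem exists_perm_path : ∀ M : Fin 3 → Fin 3 → Bool,
    (∀ i, ∃ j, M i j = false) → (∀ j, ∃ i, M i j = false) →
    (∀ i i' j j', i ≠ i' → j ≠ j' → (M i j && M i j' && M i' j && M i' j') = false) →
    (∑ i, ∑ j, (M i j).toNat) = 5 →
    ∃ π ρ : Equiv.Perm (Fin 3), ∀ i j, M (π i) (ρ j) = decide (j = i ∨ i.val = j.val + 1) := by
  decide +kernel

theorem exists_pathLists (hK : G.CliqueFree 4) {T T' : Finset V} (hT : G.IsNClique 3 T)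
    (hT' : G.IsNClique 3 T') (h : G.excess T T' = 1) : ∃ a b, PathLists G T T' a b := by
  obtain ⟨a, ha⟩ := hT.exists_lists
  obtain ⟨b, hb⟩ := hT'.exists_lists
  obtain ⟨π, ρ, hπρ⟩ := exists_perm_path (fun i j => decide (G.Adj (a i) (b j))) (by
      intro i
      by_contra! hi
      simp only [ne_eq, decide_eq_false_iff_not, not_not] at hi
      exact not_adj_of_cliqueFree_four hK (hi 0) (hi 1) (hi 2) (hb.adj 0 1 (by decide))
        (hb.adj 0 2 (by decide)) (hb.adj 1 2 (by decide))) (by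
      intro j
      by_contra! hj
      simp only [ne_eq, decide_eq_false_iff_not, not_not] at hj
      exact not_adj_of_cliqueFree_four hK (hj 0).symm (hj 1).symm (hj 2).symm
        (ha.adj 0 1 (by decide)) (ha.adj 0 2 (by decide)) (ha.adj 1 2 (by decide))) (by
      intro i i' j j' hi hj
      by_contra hc
      simp only [Bool.not_eq_false, Bool.and_eq_true, decide_eq_true_eq] at hc
      obtain ⟨⟨⟨h1, h2⟩, h3⟩, h4⟩ := hc
      exact not_adj_of_cliqueFree_four hK (ha.adj i i' hi) h1 h2 h3 h4 (hb.adj j j' hj)) (by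
      simp only [excess, edgesAcross, ha.sum_eq, hb.sum_eq, ha.card_eq, hb.card_eq,
        adjInt_eq_toNat] at h
      have : ((∑ i, ∑ j, (decide (G.Adj (a i) (b j))).toNat : ℕ) : ℤ) = 5 := by
        push_cast at h ⊢
        linarith
      exact_mod_cast this)
  exact ⟨a ∘ π, b ∘ ρ, ha.comp π, hb.comp ρ, fun i j => decide_eq_decide.1 (hπρ i j)⟩

namespace PathLists

variable {T T' : Finset V} {a b : Fin 3 → V}

theorem adjInt_eq (h : PathLists G T T' a b) (i j : Fin 3) :
    G.adjInt (a i) (b j) = if j = i ∨ i.val = j.val + 1 then 1 else 0 := by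
  simp [adjInt, h.adj_iff]

theorem surplus_singleton (h : PathLists G T T' a b) (s : V) :
    G.surplus T T' {s} = 3 + (G.adjInt (a 0) s * G.adjInt (b 0) s +
      G.adjInt (a 1) s * G.adjInt (b 0) s + G.adjInt (a 1) s * G.adjInt (b 1) s +
      G.adjInt (a 2) s * G.adjInt (b 1) s + G.adjInt (a 2) s * G.adjInt (b 2) s) -
      (G.adjInt (a 0) s + G.adjInt (a 1) s + G.adjInt (a 2) s) -
      (G.adjInt (b 0) s + G.adjInt (b 1) s + G.adjInt (b 2) s) := by
  simp only [surplus, trianglesAcross, excess, edgesAcross, Finset.sum_singleton, h.left.sum_eq,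
    h.right.sum_eq, Fin.sum_univ_three, h.left.card_eq, h.right.card_eq, Finset.card_singleton,
    h.adjInt_eq]
  simp
  ring

/-- The vertices with vanishing surplus are joined to the path in one of three ways. -/
theorem of_surplus_singleton_eq_zero (hK : G.CliqueFree 4) (h : PathLists G T T' a b) {s : V}
    (hs : G.surplus T T' {s} = 0) :
    G.adjInt (a 0) s = 1 ∧ G.adjInt (a 2) s = 0 ∧ G.adjInt (b 0) s = 0 ∧ G.adjInt (b 2) s = 1 ∧
      1 ≤ G.adjInt (a 1) s + G.adjInt (b 1) s := by
  rw [h.surplus_singleton] at hs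
  have h1 := sum_adjInt_triangle_le_two hK h.left s
  have h2 := sum_adjInt_triangle_le_two hK h.right s
  rcases adjInt_eq_zero_or_one (G := G) (a 0) s with e1 | e1 <;>
  rcases adjInt_eq_zero_or_one (G := G) (a 1) s with e2 | e2 <;>
  rcases adjInt_eq_zero_or_one (G := G) (a 2) s with e3 | e3 <;>
  rcases adjInt_eq_zero_or_one (G := G) (b 0) s with e4 | e4 <;>
  rcases adjInt_eq_zero_or_one (G := G) (b 1) s with e5 | e5 <;>
  rcases adjInt_eq_zero_or_one (G := G) (b 2) s with e6 | e6 <;>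
  simp [e1, e2, e3, e4, e5, e6] at hs h1 h2 ⊢

theorem of_adj_of_surplus_singleton_eq_zero (hK : G.CliqueFree 4) (h : PathLists G T T' a b)
    {u v : V} (huv : G.Adj u v) (hu : G.surplus T T' {u} = 0) (hv : G.surplus T T' {v} = 0) :
    G.adjInt (a 1) u + G.adjInt (a 1) v = 1 ∧ G.adjInt (b 1) u + G.adjInt (b 1) v = 1 ∧
      G.adjInt (a 1) u + G.adjInt (b 1) u = 1 ∧ G.adjInt (a 1) v + G.adjInt (b 1) v = 1 := by
  obtain ⟨u1, -, -, u6, u7⟩ := h.of_surplus_singleton_eq_zero hK hu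
  obtain ⟨v1, -, -, v6, v7⟩ := h.of_surplus_singleton_eq_zero hK hv
  have h1 := sum_adjInt_le_five hK (a 0) (a 1) u v
  have h2 := sum_adjInt_le_five hK (b 1) (b 2) u v
  rw [adjInt_eq_one (h.left.adj 0 1 (by decide)), adjInt_eq_one huv, u1, v1] at h1
  rw [adjInt_eq_one (h.right.adj 1 2 (by decide)), adjInt_eq_one huv, u6, v6] at h2
  lia

/-- The position of an edge that has negative surplus together with two triangles. -/
structure Blocks (G : SimpleGraph V) [DecidableRel G.Adj] (a b : Fin 3 → V) (u v : V) :
    Prop where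
  adj : G.Adj u v
  a0u : G.adjInt (a 0) u = 1
  a1u : G.adjInt (a 1) u = 1
  a2u : G.adjInt (a 2) u = 0
  b0u : G.adjInt (b 0) u = 0
  b1u : G.adjInt (b 1) u = 0
  b2u : G.adjInt (b 2) u = 1
  a0v : G.adjInt (a 0) v = 1
  a1v : G.adjInt (a 1) v = 0
  a2v : G.adjInt (a 2) v = 0
  b0v : G.adjInt (b 0) v = 0
  b1v : G.adjInt (b 1) v = 1
  b2v : G.adjInt (b 2) v = 1

theorem blocks_of_adj (hK : G.CliqueFree 4) (h : PathLists G T T' a b)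
    {u v : V} (huv : G.Adj u v) (hu : G.surplus T T' {u} = 0) (hv : G.surplus T T' {v} = 0) :
    Blocks G a b u v ∨ Blocks G a b v u := by
  obtain ⟨h1, h2, h3, h4⟩ := h.of_adj_of_surplus_singleton_eq_zero hK huv hu hv
  obtain ⟨u1, u2, u3, u4, -⟩ := h.of_surplus_singleton_eq_zero hK hu
  obtain ⟨v1, v2, v3, v4, -⟩ := h.of_surplus_singleton_eq_zero hK hv
  rcases adjInt_eq_zero_or_one (G := G) (a 1) u with h5 | h5
  · exact Or.inr ⟨huv.symm, v1, by lia, v2, v3, by lia, v4, u1, h5, u2, u3, by lia, u4⟩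
  · exact Or.inl ⟨huv, u1, h5, u2, u3, by lia, u4, v1, by lia, v2, v3, by lia, v4⟩

theorem exists_blocks (hK : G.CliqueFree 4) (h : PathLists G T T' a b) {Q : Finset V}
    (hQ : G.IsNClique 2 Q) (hσ : ∀ w ∈ Q, G.surplus T T' {w} = 0) :
    ∃ u v, Q = {u, v} ∧ Blocks G a b u v := by
  obtain ⟨u, v, huv, rfl⟩ := hQ.exists_pair
  rcases h.blocks_of_adj hK huv (hσ u (by simp)) (hσ v (by simp)) with h | h
  · exact ⟨u, v, rfl, h⟩
  · exact ⟨v, u, Finset.pair_comm u v, h⟩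

end PathLists

theorem one_le_surplus_add_surplus_pair_singleton (hK : G.CliqueFree 4) {T T' Q : Finset V}
    (hT : G.IsNClique 3 T) (hT' : G.IsNClique 3 T') (hQ : G.IsNClique 2 Q)
    (hneg : G.surplus T T' Q < 0) {s : V} (hs : G.excess Q {s} ≤ 0) :
    1 ≤ G.surplus T Q {s} + G.surplus T' Q {s} := by
  obtain h | ⟨-, hx, hx1, hx2, hσ⟩ := surplus_triangle_triangle_pair hK hT hT' hQ
  · linarith
  obtain ⟨a, b, hab⟩ := exists_pathLists hK hT hT' hx
  have p1 := surplus_triangle_pair_singleton hK hT hQ s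
  have p2 := surplus_triangle_pair_singleton hK hT' hQ s
  obtain ⟨u, v, rfl, hB⟩ := hab.exists_blocks hK hQ hσ
  have q1 := sum_adjInt_triangle_le_two hK hab.left s
  have q2 := sum_adjInt_triangle_le_two hK hab.right s
  have a2 := G.adjInt_le_one (a 2) s
  have b0 := G.adjInt_le_one (b 0) s
  have hne := hB.adj.ne
  have e1 : G.surplus T {u, v} {s} = G.adjInt u s * (G.adjInt (a 0) s + G.adjInt (a 1) s) +
      G.adjInt v s * G.adjInt (a 0) s - (G.adjInt (a 0) s + G.adjInt (a 1) s + G.adjInt (a 2) s)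
      + 3 - G.adjInt u s - G.adjInt v s := by
    rw [surplus, hx1]
    simp only [trianglesAcross, excess, edgesAcross, Finset.sum_singleton, hab.left.sum_eq,
      Fin.sum_univ_three, hab.left.card_eq, Finset.card_singleton, Finset.sum_pair hne,
      Finset.card_pair hne, hB.a0u, hB.a1u, hB.a2u, hB.a0v, hB.a1v, hB.a2v]
    push_cast
    ring
  have e2 : G.surplus T' {u, v} {s} = G.adjInt u s * G.adjInt (b 2) s +
      G.adjInt v s * (G.adjInt (b 1) s + G.adjInt (b 2) s)
      - (G.adjInt (b 0) s + G.adjInt (b 1) s + G.adjInt (b 2) s)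
      + 3 - G.adjInt u s - G.adjInt v s := by
    rw [surplus, hx2]
    simp only [trianglesAcross, excess, edgesAcross, Finset.sum_singleton, hab.right.sum_eq,
      Fin.sum_univ_three, hab.right.card_eq, Finset.card_singleton, Finset.sum_pair hne,
      Finset.card_pair hne, hB.b0u, hB.b1u, hB.b2u, hB.b0v, hB.b1v, hB.b2v]
    push_cast
    ring
  simp only [excess, edgesAcross, Finset.sum_pair hne, Finset.sum_singleton,
    Finset.card_pair hne, Finset.card_singleton] at hs
  push_cast at hs
  rcases adjInt_eq_zero_or_one (G := G) u s with us | us <;>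
    rcases adjInt_eq_zero_or_one (G := G) v s with vs | vs <;>
    rw [us, vs] at e1 e2 hs <;> linarith

theorem four_le_surplus_add_surplus_pair_pair (hK : G.CliqueFree 4) {T T' Q Q' : Finset V}
    (hT : G.IsNClique 3 T) (hT' : G.IsNClique 3 T') (hQ : G.IsNClique 2 Q)
    (hQ' : G.IsNClique 2 Q') (hneg : G.surplus T T' Q < 0) (hneg' : G.surplus T T' Q' < 0) :
    4 ≤ G.surplus T Q Q' + G.surplus T' Q Q' := by
  obtain h | ⟨-, hx, hx1, hx2, hσ⟩ := surplus_triangle_triangle_pair hK hT hT' hQ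
  · linarith
  obtain h | ⟨-, -, hx1', hx2', hσ'⟩ := surplus_triangle_triangle_pair hK hT hT' hQ'
  · linarith
  obtain ⟨a, b, hab⟩ := exists_pathLists hK hT hT' hx
  obtain ⟨u, v, rfl, hB⟩ := hab.exists_blocks hK hQ hσ
  obtain ⟨u', v', rfl, hB'⟩ := hab.exists_blocks hK hQ' hσ'
  have hne := hB.adj.ne
  have hne' := hB'.adj.ne
  have hu : G.adjInt u u' = 0 := by
    have h1 := sum_adjInt_le_five hK (a 0) (a 1) u u'
    rw [adjInt_eq_one (hab.left.adj 0 1 (by decide)), hB.a0u, hB.a1u, hB'.a0u, hB'.a1u] at h1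
    have := G.adjInt_nonneg u u'
    lia
  have hv : G.adjInt v v' = 0 := by
    have h1 := sum_adjInt_le_five hK (b 1) (b 2) v v'
    rw [adjInt_eq_one (hab.right.adj 1 2 (by decide)), hB.b1v, hB.b2v, hB'.b1v, hB'.b2v] at h1
    have := G.adjInt_nonneg v v'
    lia
  have e1 : G.surplus T {u, v} {u', v'} = 2 := by
    rw [surplus, hx1, hx1']
    simp only [trianglesAcross, excess, edgesAcross, hab.left.sum_eq,
      Fin.sum_univ_three, Finset.sum_pair hne, Finset.sum_pair hne',
      Finset.card_pair hne, Finset.card_pair hne', hB.a0u, hB.a1u, hB.a2u, hB.a0v, hB.a1v, hB.a2v,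
      hB'.a0u, hB'.a1u, hB'.a2u, hB'.a0v, hB'.a1v, hB'.a2v, hu, hv]
    push_cast
    ring
  have e2 : G.surplus T' {u, v} {u', v'} = 2 := by
    rw [surplus, hx2, hx2']
    simp only [trianglesAcross, excess, edgesAcross, hab.right.sum_eq,
      Fin.sum_univ_three, Finset.sum_pair hne, Finset.sum_pair hne',
      Finset.card_pair hne, Finset.card_pair hne', hB.b0u, hB.b1u, hB.b2u, hB.b0v, hB.b1v, hB.b2v,
      hB'.b0u, hB'.b1u, hB'.b2u, hB'.b0v, hB'.b1v, hB'.b2v, hu, hv]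
    push_cast
    ring
  rw [e1, e2]
  norm_num

theorem PathLists.exists_of_surplus_neg (hK : G.CliqueFree 4) {T T' T'' : Finset V}
    {a b : Fin 3 → V} (h : PathLists G T T' a b) (hT : G.IsNClique 3 T) (hT' : G.IsNClique 3 T')
    (hT'' : G.IsNClique 3 T'') (hx : G.excess T T' = 1) :
    0 ≤ G.surplus T T' T'' ∨ G.surplus T T' T'' = -1 ∧ ∃ c, Lists G T'' c ∧
      Blocks G a b (c 0) (c 1) ∧ G.surplus T T' {c 2} = 1 := by
  obtain ⟨c, hc⟩ := hT''.exists_lists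
  have hsum := surplus_eq_sum_of_triangles hT hT' T''
  rw [hc.card_eq, hx, hc.sum_eq, Fin.sum_univ_three] at hsum
  push_cast at hsum
  have hpos (i) := surplus_triangle_triangle_singleton hK hT hT' (c i)
  have key (i j k : Fin 3) (hij : i ≠ j) (hik : i ≠ k) (hjk : j ≠ k)
      (hi : G.surplus T T' {c i} = 0) (hj : G.surplus T T' {c j} = 0)
      (hk : G.surplus T T' {c k} ≤ 1) :
      ∃ c, Lists G T'' c ∧ Blocks G a b (c 0) (c 1) ∧ G.surplus T T' {c 2} = 1 := by
    have hk' : G.surplus T T' {c k} = 1 := by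
      by_contra hne
      have hk0 : G.surplus T T' {c k} = 0 := by have := hpos k; lia
      have h1 := h.of_adj_of_surplus_singleton_eq_zero hK (hc.adj i j hij) hi hj
      have h2 := h.of_adj_of_surplus_singleton_eq_zero hK (hc.adj i k hik) hi hk0
      have h3 := h.of_adj_of_surplus_singleton_eq_zero hK (hc.adj j k hjk) hj hk0
      lia
    have hperm : ∀ i j k : Fin 3, i ≠ j → i ≠ k → j ≠ k →
        ∃ π : Equiv.Perm (Fin 3), π 0 = i ∧ π 1 = j ∧ π 2 = k := by decide
    rcases h.blocks_of_adj hK (hc.adj i j hij) hi hj with hB | hB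
    · obtain ⟨π, rfl, rfl, rfl⟩ := hperm i j k hij hik hjk
      exact ⟨c ∘ π, hc.comp π, hB, hk'⟩
    · obtain ⟨π, rfl, rfl, rfl⟩ := hperm j i k hij.symm hjk hik
      exact ⟨c ∘ π, hc.comp π, hB, hk'⟩
  have h0 := hpos 0
  have h1 := hpos 1
  have h2 := hpos 2
  by_cases hneg : 0 ≤ G.surplus T T' T''
  · exact Or.inl hneg
  refine Or.inr ?_
  have hex : ∃ c, Lists G T'' c ∧ Blocks G a b (c 0) (c 1) ∧ G.surplus T T' {c 2} = 1 := by
    by_cases e0 : G.surplus T T' {c 0} = 0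
    · by_cases e1 : G.surplus T T' {c 1} = 0
      · exact key 0 1 2 (by decide) (by decide) (by decide) e0 e1 (by linarith)
      · exact key 0 2 1 (by decide) (by decide) (by decide) e0 (by lia) (by lia)
    · exact key 1 2 0 (by decide) (by decide) (by decide) (by lia) (by lia) (by lia)
  refine ⟨?_, hex⟩
  by_contra hne
  have e0 : G.surplus T T' {c 0} = 0 := by lia
  have e1 : G.surplus T T' {c 1} = 0 := by lia
  have e2 : G.surplus T T' {c 2} = 0 := by lia
  have h3 := h.of_adj_of_surplus_singleton_eq_zero hK (hc.adj 0 1 (by decide)) e0 e1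
  have h4 := h.of_adj_of_surplus_singleton_eq_zero hK (hc.adj 0 2 (by decide)) e0 e2
  have h5 := h.of_adj_of_surplus_singleton_eq_zero hK (hc.adj 1 2 (by decide)) e1 e2
  lia

set_option maxRecDepth 100000 in
set_option synthInstance.maxHeartbeats 400000 in
set_option synthInstance.maxSize 1000 in
theorem surplus_bits_bound : ∀ t1 t2 u0 u1 : Bool,
    u0.toNat + t1.toNat + u1.toNat ≤ 2 → t1.toNat + u1.toNat + t2.toNat ≤ 2 →
    ((t1 && u0).toNat + (t1 && u1).toNat + (t2 && u1).toNat + 2 =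
      t1.toNat + t2.toNat + u0.toNat + u1.toNat) →
    ∀ x0 x1 x2 : Bool, x0.toNat + x1.toNat + x2.toNat ≤ 2 →
    ∀ y0 y1 y2 : Bool, y0.toNat + y1.toNat + y2.toNat ≤ 2 →
    x0.toNat + x1.toNat + y0.toNat ≤ 2 → x1.toNat + y1.toNat + y0.toNat ≤ 2 →
    x1.toNat + x2.toNat + y1.toNat ≤ 2 → x2.toNat + y1.toNat + y2.toNat ≤ 2 →
    ∀ z0 z1 z2 : Bool, z0.toNat + z1.toNat + z2.toNat ≤ 2 →
    x0.toNat + x1.toNat + z0.toNat ≤ 2 → y1.toNat + y2.toNat + z1.toNat ≤ 2 →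
    x0.toNat + z0.toNat + z1.toNat ≤ 2 → y2.toNat + z0.toNat + z1.toNat ≤ 2 →
    t1.toNat + x1.toNat + z0.toNat + z2.toNat ≤ 3 →
    u1.toNat + y1.toNat + z1.toNat + z2.toNat ≤ 3 →
    t1.toNat + u0.toNat + x1.toNat + y0.toNat + z2.toNat ≤ 4 →
    t1.toNat + u1.toNat + x1.toNat + y1.toNat + z2.toNat ≤ 4 →
    t2.toNat + u1.toNat + x2.toNat + y1.toNat + z2.toNat ≤ 4 →
    t1.toNat + t2.toNat + x1.toNat + x2.toNat + z2.toNat ≤ 4 →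
    u0.toNat + u1.toNat + y0.toNat + y1.toNat + z2.toNat ≤ 4 →
    2 * (x0.toNat + x1.toNat + x2.toNat + y0.toNat + y1.toNat + y2.toNat +
        z0.toNat + z1.toNat + z2.toNat) + t1.toNat + t2.toNat + u0.toNat + u1.toNat ≤
      11 + ((x0 && y0).toNat + (x1 && y0).toNat + (x1 && y1).toNat + (x2 && y1).toNat +
        (x2 && y2).toNat) +
      ((x0 && z0).toNat + (x1 && z0).toNat + (x0 && z1).toNat + (t1 && x1 && z2).toNat +
        (t2 && x2 && z2).toNat) +
      ((y2 && z0).toNat + (y1 && z1).toNat + (y2 && z1).toNat + (u0 && y0 && z2).toNat +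
        (u1 && y1 && z2).toNat) := by
  decide +kernel

theorem two_le_of_path (hK : G.CliqueFree 4) {T T' T'' : Finset V}
    {a b c : Fin 3 → V} (h : PathLists G T T' a b) (hc : Lists G T'' c)
    (hB : PathLists.Blocks G a b (c 0) (c 1)) (h2 : G.surplus T T' {c 2} = 1) (s : V) :
    2 ≤ G.surplus T T' {s} + G.surplus T T'' {s} + G.surplus T' T'' {s} := by
  have ha01 := adjInt_eq_one (h.left.adj 0 1 (by decide))
  have ha12 := adjInt_eq_one (h.left.adj 1 2 (by decide))
  have hb01 := adjInt_eq_one (h.right.adj 0 1 (by decide))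
  have hb12 := adjInt_eq_one (h.right.adj 1 2 (by decide))
  have hc01 := adjInt_eq_one (hc.adj 0 1 (by decide))
  have hc02 := adjInt_eq_one (hc.adj 0 2 (by decide))
  have hc12 := adjInt_eq_one (hc.adj 1 2 (by decide))
  have e00 : G.adjInt (a 0) (b 0) = 1 := by simp [h.adjInt_eq]
  have e10 : G.adjInt (a 1) (b 0) = 1 := by simp [h.adjInt_eq]
  have e11 : G.adjInt (a 1) (b 1) = 1 := by simp [h.adjInt_eq]
  have e21 : G.adjInt (a 2) (b 1) = 1 := by simp [h.adjInt_eq]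
  have e22 : G.adjInt (a 2) (b 2) = 1 := by simp [h.adjInt_eq]
  have t0 : G.adjInt (a 0) (c 2) = 0 := by
    have := sum_adjInt_le_five hK (a 0) (c 0) (c 1) (c 2)
    rw [hB.a0u, hB.a0v, hc01, hc02, hc12] at this
    have := G.adjInt_nonneg (a 0) (c 2)
    lia
  have u2 : G.adjInt (b 2) (c 2) = 0 := by
    have := sum_adjInt_le_five hK (b 2) (c 0) (c 1) (c 2)
    rw [hB.b2u, hB.b2v, hc01, hc02, hc12] at this
    have := G.adjInt_nonneg (b 2) (c 2)
    lia
  have g := sum_adjInt_le_five hK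
  have p1 (w) := g (a 0) (a 1) (b 0) w
  have p2 (w) := g (a 1) (b 0) (b 1) w
  have p3 (w) := g (a 1) (a 2) (b 1) w
  have p4 (w) := g (a 2) (b 1) (b 2) w
  have q1 := g (a 0) (a 1) (c 0) s
  have q2 := g (b 1) (b 2) (c 1) s
  have q3 := g (a 0) (c 0) (c 1) s
  have q4 := g (b 2) (c 0) (c 1) s
  have q5 := g (a 1) (c 0) (c 2) s
  have q6 := g (b 1) (c 1) (c 2) s
  have q7 := g (a 1) (b 0) (c 2) s
  have q8 := g (a 1) (b 1) (c 2) s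
  have q9 := g (a 2) (b 1) (c 2) s
  have q10 := g (a 1) (a 2) (c 2) s
  have q11 := g (b 0) (b 1) (c 2) s
  have r1 := sum_adjInt_triangle_le_two hK h.left s
  have r2 := sum_adjInt_triangle_le_two hK h.right s
  have r3 := sum_adjInt_triangle_le_two hK hc s
  simp only [ha01, ha12, hb01, hb12, hc01, hc02, hc12, e00, e10, e11, e21, e22, hB.a0u,
    hB.a1u, hB.a0v, hB.b2u, hB.b1v, hB.b2v] at p1 p2 p3 p4 q1 q2 q3 q4 q5 q6 q7 q8 q9 q10 q11
  have hs2 := h.surplus_singleton (c 2)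
  rw [h2, t0, u2] at hs2
  have e1 := h.surplus_singleton s
  have e2 : G.surplus T T'' {s} = G.adjInt (a 0) s * G.adjInt (c 0) s +
      G.adjInt (a 1) s * G.adjInt (c 0) s + G.adjInt (a 0) s * G.adjInt (c 1) s +
      G.adjInt (a 1) (c 2) * G.adjInt (a 1) s * G.adjInt (c 2) s +
      G.adjInt (a 2) (c 2) * G.adjInt (a 2) s * G.adjInt (c 2) s
      - (G.adjInt (a 1) (c 2) + G.adjInt (a 2) (c 2))
      - (G.adjInt (a 0) s + G.adjInt (a 1) s + G.adjInt (a 2) s)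
      - (G.adjInt (c 0) s + G.adjInt (c 1) s + G.adjInt (c 2) s) + 5 := by
    simp only [surplus, trianglesAcross, excess, edgesAcross, Finset.sum_singleton, h.left.sum_eq,
      hc.sum_eq, Fin.sum_univ_three, h.left.card_eq, hc.card_eq, Finset.card_singleton, hB.a0u,
      hB.a1u, hB.a2u, hB.a0v, hB.a1v, hB.a2v, t0]
    push_cast
    ring
  have e3 : G.surplus T' T'' {s} = G.adjInt (b 2) s * G.adjInt (c 0) s +
      G.adjInt (b 1) s * G.adjInt (c 1) s + G.adjInt (b 2) s * G.adjInt (c 1) s +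
      G.adjInt (b 0) (c 2) * G.adjInt (b 0) s * G.adjInt (c 2) s +
      G.adjInt (b 1) (c 2) * G.adjInt (b 1) s * G.adjInt (c 2) s
      - (G.adjInt (b 0) (c 2) + G.adjInt (b 1) (c 2))
      - (G.adjInt (b 0) s + G.adjInt (b 1) s + G.adjInt (b 2) s)
      - (G.adjInt (c 0) s + G.adjInt (c 1) s + G.adjInt (c 2) s) + 5 := by
    simp only [surplus, trianglesAcross, excess, edgesAcross, Finset.sum_singleton, h.right.sum_eq,
      hc.sum_eq, Fin.sum_univ_three, h.right.card_eq, hc.card_eq, Finset.card_singleton, hB.b0u,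
      hB.b1u, hB.b2u, hB.b0v, hB.b1v, hB.b2v, u2]
    push_cast
    ring
  rw [e1, e2, e3]
  have p2' := p2 (c 2)
  have p3' := p3 (c 2)
  replace p1 := p1 s
  replace p2 := p2 s
  replace p3 := p3 s
  replace p4 := p4 s
  have bit (u v : V) : ∃ x : Bool, G.adjInt u v = x.toNat := ⟨_, adjInt_eq_toNat _ _⟩
  obtain ⟨t1, ht1⟩ := bit (a 1) (c 2)
  obtain ⟨t2, ht2⟩ := bit (a 2) (c 2)
  obtain ⟨u0, hu0⟩ := bit (b 0) (c 2)
  obtain ⟨u1, hu1⟩ := bit (b 1) (c 2)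
  obtain ⟨x0, hx0⟩ := bit (a 0) s
  obtain ⟨x1, hx1⟩ := bit (a 1) s
  obtain ⟨x2, hx2⟩ := bit (a 2) s
  obtain ⟨y0, hy0⟩ := bit (b 0) s
  obtain ⟨y1, hy1⟩ := bit (b 1) s
  obtain ⟨y2, hy2⟩ := bit (b 2) s
  obtain ⟨z0, hz0⟩ := bit (c 0) s
  obtain ⟨z1, hz1⟩ := bit (c 1) s
  obtain ⟨z2, hz2⟩ := bit (c 2) s
  have hand (x y : Bool) : (((x && y).toNat : ℕ) : ℤ) = x.toNat * y.toNat := by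
    cases x <;> cases y <;> rfl
  simp only [ht1, ht2, hu0, hu1, hx0, hx1, hx2, hy0, hy1, hy2, hz0, hz1, hz2] at *
  have key := surplus_bits_bound t1 t2 u0 u1 (by lia) (by lia) (by
      zify
      simp only [hand]
      linarith) x0 x1 x2 (by lia) y0 y1 y2 (by lia) (by lia) (by lia) (by lia) (by lia)
    z0 z1 z2 (by lia) (by lia) (by lia) (by lia) (by lia) (by lia) (by lia) (by lia) (by lia)
    (by lia) (by lia) (by lia)
  zify at key
  simp only [hand] at key
  linarith

/-- A triple of triangles with negative surplus is compensated by any further vertex. -/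
theorem surplus_triangles (hK : G.CliqueFree 4) {T T' T'' : Finset V} (hT : G.IsNClique 3 T)
    (hT' : G.IsNClique 3 T') (hT'' : G.IsNClique 3 T'') :
    0 ≤ G.surplus T T' T'' ∨ G.surplus T T' T'' = -1 ∧
      ∀ s, 2 ≤ G.surplus T T' {s} + G.surplus T T'' {s} + G.surplus T' T'' {s} := by
  have main {T T' T'' : Finset V} (hT : G.IsNClique 3 T) (hT' : G.IsNClique 3 T')
      (hT'' : G.IsNClique 3 T'') (hx : G.excess T T' = 1) :
      0 ≤ G.surplus T T' T'' ∨ G.surplus T T' T'' = -1 ∧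
        ∀ s, 2 ≤ G.surplus T T' {s} + G.surplus T T'' {s} + G.surplus T' T'' {s} := by
    obtain ⟨a, b, h⟩ := exists_pathLists hK hT hT' hx
    obtain h' | ⟨h1, c, hc, hB, h2⟩ := h.exists_of_surplus_neg hK hT hT' hT'' hx
    · exact Or.inl h'
    · exact Or.inr ⟨h1, fun s => two_le_of_path hK h hc hB h2 s⟩
  have large {T T' T'' : Finset V} (hT : G.IsNClique 3 T) (hT' : G.IsNClique 3 T')
      (hT'' : G.IsNClique 3 T'') (hx : 2 ≤ G.excess T T') : 0 ≤ G.surplus T T' T'' := by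
    have h1 := surplus_eq_sum_of_triangles hT hT' T''
    have h2 := Finset.sum_nonneg fun w (_ : w ∈ T'') =>
      surplus_triangle_triangle_singleton hK hT hT' w
    rw [hT''.card_eq] at h1
    push_cast at h1
    linarith
  have s1 : G.surplus T T'' T' = G.surplus T T' T'' := surplus_swap_right _ _ _
  have s2 : G.surplus T' T'' T = G.surplus T T' T'' := (surplus_rotate _ _ _).symm
  rcases lt_trichotomy (G.excess T T') 1 with h1 | h1 | h1
  · rcases lt_trichotomy (G.excess T T'') 1 with h2 | h2 | h2
    · rcases lt_trichotomy (G.excess T' T'') 1 with h3 | h3 | h3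
      · have := G.trianglesAcross_nonneg T T' T''
        left
        rw [surplus]
        lia
      · obtain h | ⟨h, h'⟩ := main hT' hT'' hT h3
        · exact Or.inl (s2 ▸ h)
        · refine Or.inr ⟨s2 ▸ h, fun s => ?_⟩
          have := h' s
          rw [surplus_swap_left T' T, surplus_swap_left T'' T] at this
          linarith
      · exact Or.inl (s2 ▸ large hT' hT'' hT h3)
    · obtain h | ⟨h, h'⟩ := main hT hT'' hT' h2
      · exact Or.inl (s1 ▸ h)
      · refine Or.inr ⟨s1 ▸ h, fun s => ?_⟩
        have := h' s
        rw [surplus_swap_left T'' T'] at this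
        linarith
    · exact Or.inl (s1 ▸ large hT hT'' hT' h2)
  · exact main hT hT' hT'' h1
  · exact Or.inl (large hT hT' hT'' h1)

theorem card_sub_two_mul_sum {α : Type*} [DecidableEq α] {A : Finset α} {p q : α} (hp : p ∈ A)
    (hq : q ∈ A) (x : ℤ) (hx : p = q → x = 0) :
    ∑ r ∈ A, (if r = p ∨ r = q then 0 else x) = (A.card - 2) * x := by
  by_cases hpq : p = q
  · simp [hx hpq]
  · have h (r : α) : (if r = p ∨ r = q then 0 else x) =
        x - (if r = p then x else 0) - (if r = q then x else 0) := by
      by_cases h1 : r = p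
      · have : r ≠ q := fun h => hpq (h1.symm.trans h)
        simp [h1, hpq]
      · simp [h1]
        split_ifs <;> simp
    simp only [h, Finset.sum_sub_distrib, Finset.sum_ite_eq', hp, hq, if_true, Finset.sum_const,
      nsmul_eq_mul]
    ring

theorem card_sub_one_mul_sum {α : Type*} [DecidableEq α] {A : Finset α} {p : α} (hp : p ∈ A)
    (x : ℤ) : ∑ r ∈ A, (if p = r then 0 else x) = (A.card - 1) * x := by
  have h (r : α) : (if p = r then 0 else x) = x - (if p = r then x else 0) := by
    split_ifs <;> simp
  simp only [h, Finset.sum_sub_distrib, Finset.sum_ite_eq, hp, if_true, Finset.sum_const,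
    nsmul_eq_mul]
  ring

/-- A symmetric function of three variables whose negative values are compensated. -/
structure Compensated {α : Type*} [DecidableEq α] (A B C : Finset α) (F : α → α → α → ℤ) :
    Prop where
  swap_left : ∀ p q r, F p q r = F q p r
  swap_right : ∀ p q r, F p q r = F p r q
  diag : ∀ p q, F p p q = 0
  nonneg : ∀ p ∈ A ∪ B ∪ C, ∀ q ∈ B ∪ C, ∀ r ∈ B ∪ C, 0 ≤ F p q r
  nonneg_third : ∀ p ∈ A, ∀ q ∈ A, ∀ s ∈ C, 0 ≤ F p q s
  first : ∀ p ∈ A, ∀ q ∈ A, ∀ r ∈ A,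
    0 ≤ F p q r ∨ F p q r = -1 ∧ ∀ s ∈ C, 2 ≤ F p q s + F p r s + F q r s
  second : ∀ p ∈ A, ∀ q ∈ A, ∀ t ∈ B,
    0 ≤ F p q t ∨ F p q t = -1 ∧ ∀ s ∈ C, 1 ≤ F p t s + F q t s
  second_pair : ∀ p ∈ A, ∀ q ∈ A, ∀ t ∈ B, ∀ t' ∈ B, F p q t < 0 → F p q t' < 0 → t ≠ t' →
    4 ≤ F p t t' + F q t t'

/-- The indicator of negative integers. -/
def negInd (x : ℤ) : ℤ := if x < 0 then 1 else 0

theorem negInd_nonneg (x : ℤ) : 0 ≤ negInd x := by unfold negInd; split_ifs <;> simp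

theorem negInd_le_one (x : ℤ) : negInd x ≤ 1 := by unfold negInd; split_ifs <;> simp

theorem negInd_of_nonneg {x : ℤ} (hx : 0 ≤ x) : negInd x = 0 := by simp [negInd, hx]

theorem negInd_of_neg {x : ℤ} (hx : x < 0) : negInd x = 1 := by simp [negInd, hx]

namespace Compensated

variable {α : Type*} [DecidableEq α] {A B C : Finset α} {F : α → α → α → ℤ}

/-- The number of triples in `A` with a negative value. -/
def negTriples (A : Finset α) (F : α → α → α → ℤ) : ℤ :=
  ∑ p ∈ A, ∑ q ∈ A, ∑ r ∈ A, negInd (F p q r)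

/-- The number of elements of `B` having a negative value together with `p` and `q`. -/
def negDeg (B : Finset α) (F : α → α → α → ℤ) (p q : α) : ℤ := ∑ t ∈ B, negInd (F p q t)

theorem neg_negTriples_le (h : Compensated A B C F) :
    -negTriples A F ≤ ∑ p ∈ A, ∑ q ∈ A, ∑ r ∈ A, F p q r := by
  simp only [negTriples, ← Finset.sum_neg_distrib]
  refine Finset.sum_le_sum fun p hp => Finset.sum_le_sum fun q hq =>
    Finset.sum_le_sum fun r hr => ?_
  obtain h1 | ⟨h1, -⟩ := h.first p hp q hq r hr
  · rw [negInd_of_nonneg h1]; simpa using h1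
  · rw [h1]; decide

theorem negTriples_nonneg : 0 ≤ negTriples A F :=
  Finset.sum_nonneg fun _ _ => Finset.sum_nonneg fun _ _ => Finset.sum_nonneg fun _ _ =>
    negInd_nonneg _

theorem diag_right (h : Compensated A B C F) (p q : α) : F p q q = 0 := by
  rw [h.swap_left, h.swap_right, h.diag]

theorem diag_outer (h : Compensated A B C F) (p q : α) : F p q p = 0 := by
  rw [h.swap_right, h.diag]

theorem negTriples_le (h : Compensated A B C F) :
    negTriples A F ≤ A.card * ((A.card - 1) * (A.card - 2)) := by
  have h1 (p) (hp : p ∈ A) (q) (hq : q ∈ A) :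
      ∑ r ∈ A, negInd (F p q r) ≤ if p = q then 0 else ((A.card : ℤ) - 2) := by
    have h2 := card_sub_two_mul_sum hp hq (if p = q then 0 else 1) (by simp +contextual)
    have h3 : (if p = q then (0 : ℤ) else (A.card : ℤ) - 2) =
      (A.card - 2) * (if p = q then 0 else 1) := by split_ifs <;> simp
    rw [h3, ← h2]
    refine Finset.sum_le_sum fun r _ => ?_
    split_ifs with h4 h5
    · rcases h4 with rfl | rfl
      · rw [h.diag_outer]; decide
      · rw [h.diag_right]; decide
    · rw [h5, h.diag]; decide
    · exact negInd_le_one _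
  calc negTriples A F ≤ ∑ p ∈ A, ∑ q ∈ A, if p = q then 0 else ((A.card : ℤ) - 2) :=
        Finset.sum_le_sum fun p hp => Finset.sum_le_sum fun q hq => h1 p hp q hq
    _ = ∑ p ∈ A, ((A.card : ℤ) - 1) * (A.card - 2) :=
        Finset.sum_congr rfl fun p hp => card_sub_one_mul_sum hp _
    _ = _ := by simp

theorem negTriples_mul_le (h : Compensated A B C F) :
    2 * C.card * negTriples A F ≤
      3 * (A.card - 2) * ∑ p ∈ A, ∑ q ∈ A, ∑ s ∈ C, F p q s := by
  have h1 (s) (hs : s ∈ C) : 2 * negTriples A F ≤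
      3 * ((A.card - 2) * ∑ p ∈ A, ∑ q ∈ A, F p q s) := by
    have h2 : ∑ p ∈ A, ∑ q ∈ A, ∑ r ∈ A, (if r = p ∨ r = q then 0 else F p q s) =
        (A.card - 2) * ∑ p ∈ A, ∑ q ∈ A, F p q s := by
      simp only [Finset.mul_sum]
      refine Finset.sum_congr rfl fun p hp => Finset.sum_congr rfl fun q hq => ?_
      exact card_sub_two_mul_sum hp hq _ (by rintro rfl; exact h.diag _ _)
    have h3 : ∑ p ∈ A, ∑ q ∈ A, ∑ r ∈ A, (if q = p ∨ q = r then 0 else F p r s) =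
        (A.card - 2) * ∑ p ∈ A, ∑ q ∈ A, F p q s := by
      rw [← h2]
      exact Finset.sum_congr rfl fun p hp => Finset.sum_comm
    have h4 : ∑ p ∈ A, ∑ q ∈ A, ∑ r ∈ A, (if p = q ∨ p = r then 0 else F q r s) =
        (A.card - 2) * ∑ p ∈ A, ∑ q ∈ A, F p q s := by
      rw [← h3, Finset.sum_comm]
    have h5 : 2 * negTriples A F ≤
        ∑ p ∈ A, ∑ q ∈ A, ∑ r ∈ A, (if r = p ∨ r = q then 0 else F p q s) +
        ∑ p ∈ A, ∑ q ∈ A, ∑ r ∈ A, (if q = p ∨ q = r then 0 else F p r s) +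
        ∑ p ∈ A, ∑ q ∈ A, ∑ r ∈ A, (if p = q ∨ p = r then 0 else F q r s) := by
      simp only [negTriples, Finset.mul_sum, ← Finset.sum_add_distrib]
      refine Finset.sum_le_sum fun p hp => Finset.sum_le_sum fun q hq =>
        Finset.sum_le_sum fun r hr => ?_
      obtain h6 | ⟨h6, h7⟩ := h.first p hp q hq r hr
      · rw [negInd_of_nonneg h6]
        have := h.nonneg_third p hp q hq s hs
        have := h.nonneg_third p hp r hr s hs
        have := h.nonneg_third q hq r hr s hs
        split_ifs <;> lia
      · have hpq : p ≠ q := by rintro rfl; rw [h.diag] at h6; lia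
        have hpr : p ≠ r := by rintro rfl; rw [h.diag_outer] at h6; lia
        have hqr : q ≠ r := by rintro rfl; rw [h.diag_right] at h6; lia
        rw [h6]
        simpa [hpq, hpr, hqr, hpq.symm, hpr.symm, hqr.symm, negInd] using h7 s hs
    rw [h2, h3, h4] at h5
    linarith
  have h8 : ∑ p ∈ A, ∑ q ∈ A, ∑ s ∈ C, F p q s = ∑ s ∈ C, ∑ p ∈ A, ∑ q ∈ A, F p q s := by
    rw [Finset.sum_comm]
    simp only [Finset.sum_comm (s := C)]
    exact Finset.sum_comm
  rw [h8]
  have h9 := Finset.sum_le_sum h1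
  simp only [← Finset.mul_sum, Finset.sum_const, nsmul_eq_mul] at h9
  linarith

theorem neg_sum_negDeg_le (h : Compensated A B C F) :
    -∑ p ∈ A, ∑ q ∈ A, negDeg B F p q ≤ ∑ p ∈ A, ∑ q ∈ A, ∑ t ∈ B, F p q t := by
  simp only [negDeg, ← Finset.sum_neg_distrib]
  refine Finset.sum_le_sum fun p hp => Finset.sum_le_sum fun q hq =>
    Finset.sum_le_sum fun r hr => ?_
  obtain h1 | ⟨h1, -⟩ := h.second p hp q hq r hr
  · rw [negInd_of_nonneg h1]; simpa using h1
  · rw [h1]; decide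

theorem sum_sum_ite_add (f : α → ℤ) :
    ∑ p ∈ A, ∑ q ∈ A, ((if p = q then 0 else f p) + if p = q then 0 else f q) =
      2 * (A.card - 1) * ∑ p ∈ A, f p := by
  simp only [Finset.sum_add_distrib]
  rw [Finset.sum_comm (f := fun p q => if p = q then 0 else f q)]
  have h1 : ∑ p ∈ A, ∑ q ∈ A, (if p = q then 0 else f p) = (A.card - 1) * ∑ p ∈ A, f p := by
    rw [Finset.mul_sum]
    exact Finset.sum_congr rfl fun p hp => card_sub_one_mul_sum hp _
  have h2 : ∑ p ∈ A, ∑ q ∈ A, (if q = p then 0 else f p) = (A.card - 1) * ∑ p ∈ A, f p := by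
    simp only [← h1, eq_comm]
  rw [h1, h2]
  ring

theorem sum_negDeg_mul_le (h : Compensated A B C F) :
    C.card * ∑ p ∈ A, ∑ q ∈ A, negDeg B F p q ≤
      2 * (A.card - 1) * ∑ p ∈ A, ∑ t ∈ B, ∑ s ∈ C, F p t s := by
  rw [← sum_sum_ite_add]
  simp only [Finset.mul_sum, negDeg]
  refine Finset.sum_le_sum fun p hp => Finset.sum_le_sum fun q hq => ?_
  have h1 (p : α) (hp : p ∈ A) : 0 ≤ ∑ t ∈ B, ∑ s ∈ C, F p t s :=
    Finset.sum_nonneg fun t ht => Finset.sum_nonneg fun s hs =>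
      h.nonneg p (by simp [hp]) t (by simp [ht]) s (by simp [hs])
  split_ifs with hpq
  · subst hpq
    simp [h.diag, negInd]
  · rw [← Finset.sum_add_distrib]
    refine Finset.sum_le_sum fun t ht => ?_
    rw [← Finset.sum_add_distrib, ← nsmul_eq_mul, ← Finset.sum_const]
    refine Finset.sum_le_sum fun s hs => ?_
    obtain h6 | ⟨h6, h7⟩ := h.second p hp q hq t ht
    · rw [negInd_of_nonneg h6]
      exact add_nonneg (h.nonneg p (by simp [hp]) t (by simp [ht]) s (by simp [hs]))
        (h.nonneg q (by simp [hq]) t (by simp [ht]) s (by simp [hs]))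
    · rw [h6]
      exact h7 s hs

theorem sum_negDeg_sq_le (h : Compensated A B C F) :
    4 * ∑ p ∈ A, ∑ q ∈ A, (negDeg B F p q ^ 2 - negDeg B F p q) ≤
      2 * (A.card - 1) * ∑ p ∈ A, ∑ t ∈ B, ∑ t' ∈ B, F p t t' := by
  rw [← sum_sum_ite_add]
  simp only [Finset.mul_sum]
  refine Finset.sum_le_sum fun p hp => Finset.sum_le_sum fun q hq => ?_
  split_ifs with hpq
  · subst hpq
    simp [negDeg, h.diag, negInd]
  · have h1 : negDeg B F p q ^ 2 - negDeg B F p q = ∑ t ∈ B, ∑ t' ∈ B,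
        (negInd (F p q t) * negInd (F p q t') - if t = t' then negInd (F p q t) else 0) := by
      rw [negDeg, sq, Finset.sum_mul_sum]
      simp only [Finset.sum_sub_distrib]
      congr 1
      exact Finset.sum_congr rfl fun t ht => by simp [ht]
    simp only [h1, Finset.mul_sum, ← Finset.sum_add_distrib]
    refine Finset.sum_le_sum fun t ht => Finset.sum_le_sum fun t' ht' => ?_
    have n1 := h.nonneg p (by simp [hp]) t (by simp [ht]) t' (by simp [ht'])
    have n2 := h.nonneg q (by simp [hq]) t (by simp [ht]) t' (by simp [ht'])
    rcases le_or_gt 0 (F p q t) with h2 | h2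
    · rw [negInd_of_nonneg h2]; simp; lia
    rcases le_or_gt 0 (F p q t') with h3 | h3
    · rw [negInd_of_nonneg h3, negInd_of_neg h2]; split_ifs <;> lia
    rw [negInd_of_neg h2, negInd_of_neg h3]
    split_ifs with h4
    · lia
    · have := h.second_pair p hp q hq t ht t' ht' h2 h3 h4
      lia

theorem negDeg_self (h : Compensated A B C F) (p : α) : negDeg B F p p = 0 := by
  simp [negDeg, h.diag, negInd]

theorem negDeg_nonneg (p q : α) : 0 ≤ negDeg B F p q :=
  Finset.sum_nonneg fun _ _ => negInd_nonneg _

theorem sum_nonneg_of_subset (h : Compensated A B C F) {X Y Z : Finset α} (hX : X ⊆ A ∪ B ∪ C)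
    (hY : Y ⊆ B ∪ C) (hZ : Z ⊆ B ∪ C) : 0 ≤ ∑ p ∈ X, ∑ q ∈ Y, ∑ r ∈ Z, F p q r :=
  Finset.sum_nonneg fun _ hp => Finset.sum_nonneg fun _ hq => Finset.sum_nonneg fun _ hr =>
    h.nonneg _ (hX hp) _ (hY hq) _ (hZ hr)

theorem sum_swap_left (h : Compensated A B C F) (X Y Z : Finset α) :
    ∑ p ∈ X, ∑ q ∈ Y, ∑ r ∈ Z, F p q r = ∑ p ∈ Y, ∑ q ∈ X, ∑ r ∈ Z, F p q r := by
  rw [Finset.sum_comm]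
  simp only [fun p q r => h.swap_left p q r]

theorem sum_swap_right (h : Compensated A B C F) (X Y Z : Finset α) :
    ∑ p ∈ X, ∑ q ∈ Y, ∑ r ∈ Z, F p q r = ∑ p ∈ X, ∑ q ∈ Z, ∑ r ∈ Y, F p q r := by
  refine Finset.sum_congr rfl fun p _ => ?_
  rw [Finset.sum_comm]
  simp only [fun q r => h.swap_right p q r]

/-- Dropping some nonnegative terms. -/
theorem le_sum_union (h : Compensated A B C F) (hAB : Disjoint A B) (hABC : Disjoint (A ∪ B) C) :
    (∑ p ∈ A, ∑ q ∈ A, ∑ r ∈ A, F p q r) + 3 * (∑ p ∈ A, ∑ q ∈ A, ∑ r ∈ B, F p q r) +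
      3 * (∑ p ∈ A, ∑ q ∈ A, ∑ r ∈ C, F p q r) + 3 * (∑ p ∈ A, ∑ q ∈ B, ∑ r ∈ B, F p q r) +
      6 * (∑ p ∈ A, ∑ q ∈ B, ∑ r ∈ C, F p q r) ≤
    ∑ p ∈ A ∪ B ∪ C, ∑ q ∈ A ∪ B ∪ C, ∑ r ∈ A ∪ B ∪ C, F p q r := by
  let S (X Y Z : Finset α) : ℤ := ∑ p ∈ X, ∑ q ∈ Y, ∑ r ∈ Z, F p q r
  have hl (X Y Z) : S X Y Z = S Y X Z := h.sum_swap_left X Y Z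
  have hr (X Y Z) : S X Y Z = S X Z Y := h.sum_swap_right X Y Z
  have hn {X Y Z} (hX : X ⊆ A ∪ B ∪ C) (hY : Y ⊆ B ∪ C) (hZ : Z ⊆ B ∪ C) : 0 ≤ S X Y Z :=
    h.sum_nonneg_of_subset hX hY hZ
  have hsplit : S (A ∪ B ∪ C) (A ∪ B ∪ C) (A ∪ B ∪ C) =
      S A A A + S A A B + S A A C + (S A B A + S A B B + S A B C) + (S A C A + S A C B + S A C C) +
      (S B A A + S B A B + S B A C + (S B B A + S B B B + S B B C) +
        (S B C A + S B C B + S B C C)) +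
      (S C A A + S C A B + S C A C + (S C B A + S C B B + S C B C) +
        (S C C A + S C C B + S C C C)) := by
    simp only [S, Finset.sum_union hABC, Finset.sum_union hAB, Finset.sum_add_distrib]
  change S A A A + 3 * S A A B + 3 * S A A C + 3 * S A B B + 6 * S A B C ≤
    S (A ∪ B ∪ C) (A ∪ B ∪ C) (A ∪ B ∪ C)
  have hA : A ⊆ A ∪ B ∪ C := Finset.subset_union_left.trans Finset.subset_union_left
  have hB : B ⊆ A ∪ B ∪ C := Finset.subset_union_right.trans Finset.subset_union_left
  have hC : C ⊆ A ∪ B ∪ C := Finset.subset_union_right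
  have hB' : B ⊆ B ∪ C := Finset.subset_union_left
  have hC' : C ⊆ B ∪ C := Finset.subset_union_right
  have n1 := hn hA hC' hC'
  have n2 := hn hB hB' hB'
  have n3 := hn hB hB' hC'
  have n4 := hn hB hC' hC'
  have n5 := hn hC hC' hC'
  have e1 := hr A A B
  have e2 := hl A B A
  have e3 := hr A A C
  have e4 := hl A C A
  have e5 := hl A B B
  have e6 := hr B A B
  have e7 := hr A B C
  have e8 := hl A B C
  have e9 := hl A C B
  have e10 := hr B A C
  have e11 := hr C A B
  have e12 := hl A C C
  have e13 := hr C A C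
  have e14 := hr B B C
  have e15 := hl B C B
  have e16 := hl B C C
  have e17 := hr C B C
  rw [hsplit]
  linarith

theorem card_mul_sq_le_sum (h : Compensated A B C F) (hAB : Disjoint A B)
    (hABC : Disjoint (A ∪ B) C) :
    -(3 * A.card * ((A.card : ℤ) - C.card) ^ 2) ≤
      2 * ∑ p ∈ A ∪ B ∪ C, ∑ q ∈ A ∪ B ∪ C, ∑ r ∈ A ∪ B ∪ C, F p q r := by
  have hsum := h.le_sum_union hAB hABC
  have d1 := h.neg_negTriples_le
  have d2 := h.negTriples_le
  have d3 := h.negTriples_mul_le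
  have d4 := negTriples_nonneg (A := A) (F := F)
  have m1 := h.neg_sum_negDeg_le
  have m2 := h.sum_negDeg_mul_le
  have m3 := h.sum_negDeg_sq_le
  have n1 : 0 ≤ ∑ p ∈ A, ∑ q ∈ A, ∑ r ∈ C, F p q r :=
    Finset.sum_nonneg fun p hp => Finset.sum_nonneg fun q hq => Finset.sum_nonneg fun r hr =>
      h.nonneg_third p hp q hq r hr
  have n2 : 0 ≤ ∑ p ∈ A, ∑ q ∈ B, ∑ r ∈ B, F p q r :=
    h.sum_nonneg_of_subset (by grind) (by grind) (by grind)
  have n3 : 0 ≤ ∑ p ∈ A, ∑ q ∈ B, ∑ r ∈ C, F p q r :=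
    h.sum_nonneg_of_subset (by grind) (by grind) (by grind)
  have k1 : -(A.card * ((A.card : ℤ) - 1) * (A.card - C.card + 1) ^ 2) ≤
      8 * ∑ p ∈ A, ∑ q ∈ A,
        (2 * negDeg B F p q ^ 2 - (A.card - C.card + 1) * negDeg B F p q) := by
    have : ∑ p ∈ A, ∑ q ∈ A, (if p = q then 0 else -((A.card : ℤ) - C.card + 1) ^ 2) =
        -(A.card * ((A.card : ℤ) - 1) * (A.card - C.card + 1) ^ 2) := by
      rw [Finset.sum_congr rfl fun p hp => card_sub_one_mul_sum hp _]
      simp only [Finset.sum_const, nsmul_eq_mul]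
      ring
    rw [← this]
    simp only [Finset.mul_sum]
    refine Finset.sum_le_sum fun p _ => Finset.sum_le_sum fun q _ => ?_
    split_ifs with hpq
    · simp [hpq, h.negDeg_self]
    · linarith [sq_nonneg (4 * negDeg B F p q - ((A.card : ℤ) - C.card + 1))]
  have k2 (hac : (A.card : ℤ) - C.card ≤ 1) : 0 ≤ ∑ p ∈ A, ∑ q ∈ A,
        (2 * negDeg B F p q ^ 2 - (A.card - C.card + 1) * negDeg B F p q) := by
    refine Finset.sum_nonneg fun p _ => Finset.sum_nonneg fun q _ => ?_
    have h0 : 0 ≤ negDeg B F p q := negDeg_nonneg p q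
    rcases h0.eq_or_lt with h1 | h1
    · simp [← h1]
    · have h2 : 1 ≤ negDeg B F p q := h1
      nlinarith
  have k3 : A.card ≤ 1 → ∑ p ∈ A, ∑ q ∈ A, negDeg B F p q = 0 := fun hA =>
    Finset.sum_eq_zero fun p hp => Finset.sum_eq_zero fun q hq => by
      rw [Finset.card_le_one.1 hA p hp q hq, h.negDeg_self]
  simp only [Finset.sum_sub_distrib, ← Finset.mul_sum] at m3 k1 k2
  generalize ∑ p ∈ A ∪ B ∪ C, ∑ q ∈ A ∪ B ∪ C, ∑ r ∈ A ∪ B ∪ C, F p q r = S at *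
  generalize ∑ p ∈ A, ∑ q ∈ A, ∑ r ∈ A, F p q r = S₁ at *
  generalize ∑ p ∈ A, ∑ q ∈ A, ∑ r ∈ B, F p q r = S₂ at *
  generalize ∑ p ∈ A, ∑ q ∈ A, ∑ r ∈ C, F p q r = S₃ at *
  generalize ∑ p ∈ A, ∑ q ∈ B, ∑ r ∈ B, F p q r = S₄ at *
  generalize ∑ p ∈ A, ∑ q ∈ B, ∑ r ∈ C, F p q r = S₅ at *
  generalize negTriples A F = D at *
  generalize ∑ p ∈ A, ∑ q ∈ A, negDeg B F p q ^ 2 = K at *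
  generalize ∑ p ∈ A, ∑ q ∈ A, negDeg B F p q = M at *
  have hA0 : (0 : ℤ) ≤ A.card := by positivity
  have hC0 : (0 : ℤ) ≤ C.card := by positivity
  have k3' : (A.card : ℤ) ≤ 1 → M = 0 := fun hA => k3 (by exact_mod_cast hA)
  generalize (A.card : ℤ) = a at *
  generalize (C.card : ℤ) = c at *
  obtain ⟨x, rfl⟩ : ∃ x, a = c + x := ⟨a - c, by ring⟩
  have hx : c + x - c = x := by ring
  rw [hx] at k1 k2 ⊢
  have hD (ha : c + x ≤ 2) : D = 0 := by
    have : c + x = 0 ∨ c + x = 1 ∨ c + x = 2 := by lia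
    rcases this with h1 | h1 | h1 <;> rw [h1] at d2 <;> linarith
  have hU (ha : 3 ≤ c + x) : D * (2 * c - (c + x) + 2) ≤ (c + x - 2) * (S₁ + 3 * S₃) := by
    nlinarith
  have w1 : x ≤ 1 → 0 ≤ S₁ + 3 * S₃ := by
    intro hx1
    rcases le_or_gt (c + x) 2 with h1 | h1
    · have := hD h1
      linarith
    · have h2 : 0 ≤ D * (2 * c - (c + x) + 2) := mul_nonneg d4 (by lia)
      have h3 := h2.trans (hU h1)
      exact nonneg_of_mul_nonneg_right h3 (by lia)
  have w2 : 2 ≤ x → -((c + x) * (x ^ 2 - 3 * x + 2)) ≤ S₁ + 3 * S₃ := by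
    intro hx1
    have hq : 0 ≤ (c + x) * (x ^ 2 - 3 * x + 2) := mul_nonneg hA0 (by nlinarith)
    rcases le_or_gt (c + x) 2 with h1 | h1
    · have := hD h1
      linarith
    · have hU' := hU h1
      have hpos : 0 < c + x - 2 := by lia
      rcases le_or_gt 0 (2 * c - (c + x) + 2) with h2 | h2
      · have h3 := (mul_nonneg d4 h2).trans hU'
        have := nonneg_of_mul_nonneg_right h3 hpos
        linarith
      · have h3 := mul_le_mul_of_nonneg_right d2 (neg_nonneg.2 h2.le)
        have h4 : (c + x - 2) * ((c + x) * (c + x - 1) * (2 * c - (c + x) + 2)) ≤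
            (c + x - 2) * (S₁ + 3 * S₃) := by linarith
        have h5 := le_of_mul_le_mul_left h4 hpos
        have h6 : 0 ≤ (c + x) * (c ^ 2 + c) := mul_nonneg hA0 (by positivity)
        linarith
  have hW : 3 * (2 * K - (x + 1) * M) ≤ (c + x - 1) * (3 * S₂ + 3 * S₄ + 6 * S₅) ∨
      c + x ≤ 1 := by
    rcases le_or_gt (c + x) 1 with h1 | h1
    · exact Or.inr h1
    · left
      have := mul_le_mul_of_nonneg_left m1 (show 0 ≤ c + x - 1 by lia)
      linarith
  have w3 : x ≤ 1 → 0 ≤ 3 * S₂ + 3 * S₄ + 6 * S₅ := by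
    intro hx1
    rcases le_or_gt (c + x) 1 with h1 | h1
    · have := k3' h1
      linarith
    · have h2 : 0 ≤ (c + x - 1) * (3 * S₂ + 3 * S₄ + 6 * S₅) := by
        have := k2 hx1
        rcases hW with hW | hW <;> linarith
      exact nonneg_of_mul_nonneg_right h2 (by lia)
  have w4 : -(3 * (c + x) * (x + 1) ^ 2) ≤ 8 * (3 * S₂ + 3 * S₄ + 6 * S₅) := by
    rcases le_or_gt (c + x) 1 with h1 | h1
    · have := k3' h1
      have := mul_nonneg hA0 (sq_nonneg (x + 1))
      linarith
    · have h2 : (c + x - 1) * -(3 * (c + x) * (x + 1) ^ 2) ≤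
          (c + x - 1) * (8 * (3 * S₂ + 3 * S₄ + 6 * S₅)) := by
        rcases hW with hW | hW <;> linarith
      exact le_of_mul_le_mul_left h2 (by lia)
  rcases le_or_gt x 1 with hx1 | hx1
  · have := w1 hx1
    have := w3 hx1
    nlinarith [mul_nonneg hA0 (sq_nonneg x)]
  · have := w2 hx1
    have h5 : 0 ≤ (c + x) * (x ^ 2 + 18 * x - 19) := mul_nonneg hA0 (by nlinarith)
    nlinarith

end Compensated

/-- A maximal family of disjoint `n`-cliques inside a set of vertices. -/
theorem exists_maximal_packing (G : SimpleGraph V) {n : ℕ} (hn : n ≠ 0) (U : Finset V) :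
    ∃ F : Finset (Finset V), (∀ K ∈ F, G.IsNClique n K ∧ K ⊆ U) ∧
      (∀ K ∈ F, ∀ L ∈ F, K ≠ L → Disjoint K L) ∧
      ∀ K ⊆ U \ F.biUnion id, ¬ G.IsNClique n K := by
  induction U using Finset.strongInduction with
  | H U ih =>
    by_cases hU : ∃ K ⊆ U, G.IsNClique n K
    · obtain ⟨K, hKU, hK⟩ := hU
      have hne : K.Nonempty := by
        rw [← Finset.card_pos, hK.card_eq]
        lia
      obtain ⟨F, h1, h2, h3⟩ := ih (U \ K) (Finset.sdiff_ssubset hKU hne)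
      have hdisj : ∀ L ∈ F, Disjoint K L := fun L hL =>
        Finset.disjoint_of_subset_right (h1 L hL).2 Finset.disjoint_sdiff
      refine ⟨insert K F, ?_, ?_, ?_⟩
      · intro L hL
        rcases Finset.mem_insert.1 hL with rfl | hL
        · exact ⟨hK, hKU⟩
        · exact ⟨(h1 L hL).1, (h1 L hL).2.trans Finset.sdiff_subset⟩
      · intro L hL L' hL' hLL'
        rcases Finset.mem_insert.1 hL with e | m <;> rcases Finset.mem_insert.1 hL' with e' | m'
        · exact absurd (e.trans e'.symm) hLL'
        · exact e ▸ hdisj L' m'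
        · exact e' ▸ (hdisj L m).symm
        · exact h2 L m L' m' hLL'
      · intro L hL
        apply h3 L
        rwa [Finset.biUnion_insert, id, ← Finset.sup_eq_union, ← sdiff_sdiff_left] at hL
    · push Not at hU
      exact ⟨∅, by simp, by simp, fun K hK => hU K (by simpa using hK)⟩

/-- A partition of the vertices into triangles, edges and single vertices, found greedily. -/
structure GreedyPartition (G : SimpleGraph V) [DecidableRel G.Adj] (A B C : Finset (Finset V)) :
    Prop where
  triangle : ∀ T ∈ A, G.IsNClique 3 T
  edge : ∀ Q ∈ B, G.IsNClique 2 Q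
  single : ∀ S ∈ C, G.IsNClique 1 S
  disjoint : ∀ P ∈ A ∪ B ∪ C, ∀ Q ∈ A ∪ B ∪ C, P ≠ Q → Disjoint P Q
  cover : ∀ v, ∃ P ∈ A ∪ B ∪ C, v ∈ P
  excess_nonpos : ∀ Q ∈ B ∪ C, ∀ Q' ∈ B ∪ C, Q ≠ Q' → G.excess Q Q' ≤ 0

theorem exists_greedyPartition [Fintype V] (G : SimpleGraph V) [DecidableRel G.Adj] :
    ∃ A B C, GreedyPartition G A B C := by
  obtain ⟨A, a1, a2, a3⟩ := exists_maximal_packing G (n := 3) (by decide) Finset.univ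
  set W := Finset.univ \ A.biUnion id with hW
  obtain ⟨B, b1, b2, b3⟩ := exists_maximal_packing G (n := 2) (by decide) W
  set X := W \ B.biUnion id with hX
  obtain ⟨C, c1, c2, c3⟩ := exists_maximal_packing G (n := 1) (by decide) X
  have hAW : ∀ T ∈ A, Disjoint T W := fun T hT => by
    rw [hW]
    exact Finset.disjoint_of_subset_left (Finset.subset_biUnion_of_mem id hT)
      Finset.disjoint_sdiff
  have hBX : ∀ T ∈ B, Disjoint T X := fun T hT => by
    rw [hX]
    exact Finset.disjoint_of_subset_left (Finset.subset_biUnion_of_mem id hT)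
      Finset.disjoint_sdiff
  have hXW : X ⊆ W := Finset.sdiff_subset
  have hBCW : ∀ Q ∈ B ∪ C, Q ⊆ W := fun Q hQ => by
    rcases Finset.mem_union.1 hQ with hQ | hQ
    · exact (b1 Q hQ).2
    · exact (c1 Q hQ).2.trans hXW
  have hBC : ∀ Q ∈ B ∪ C, ∀ Q' ∈ B ∪ C, Q ≠ Q' → Disjoint Q Q' := by
    intro Q hQ Q' hQ' hne
    rcases Finset.mem_union.1 hQ with hQ | hQ <;> rcases Finset.mem_union.1 hQ' with hQ' | hQ'
    · exact b2 Q hQ Q' hQ' hne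
    · exact Finset.disjoint_of_subset_right (c1 Q' hQ').2 (hBX Q hQ)
    · exact (Finset.disjoint_of_subset_right (c1 Q hQ).2 (hBX Q' hQ')).symm
    · exact c2 Q hQ Q' hQ' hne
  have htri : ∀ u v w, u ∈ W → v ∈ W → w ∈ W → G.Adj u v → G.adjInt u w + G.adjInt v w ≤ 1 := by
    intro u v w hu hv hw huv
    by_contra! h
    have h1 := G.adjInt_le_one u w
    have h2 := G.adjInt_le_one v w
    have h3 : G.Adj u w := adj_of_adjInt (by lia)
    have h4 : G.Adj v w := adj_of_adjInt (by lia)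
    exact a3 {u, v, w} (by simp [Finset.insert_subset_iff, hu, hv, hw])
      (is3Clique_triple_iff.2 ⟨huv, h3, h4⟩)
  have hedge : ∀ u v, u ∈ X → v ∈ X → G.adjInt u v = 0 := by
    intro u v hu hv
    by_contra h
    have huv : G.Adj u v := adj_of_adjInt ((adjInt_eq_zero_or_one u v).resolve_left h)
    refine b3 {u, v} (by simp [Finset.insert_subset_iff, hu, hv]) ⟨?_, Finset.card_pair huv.ne⟩
    rw [Finset.coe_pair, isClique_pair]
    exact fun _ => huv
  have hpair : ∀ Q ∈ B, ∀ s ∈ W, ∑ u ∈ Q, G.adjInt u s ≤ 1 := by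
    intro Q hQ s hs
    have hQW := (b1 Q hQ).2
    obtain ⟨u, v, huv, rfl⟩ := (b1 Q hQ).1.exists_pair
    rw [Finset.sum_pair huv.ne]
    exact htri u v s (hQW (by simp)) (hQW (by simp)) hs huv
  have hexc : ∀ Q ∈ B, ∀ Q' ∈ B ∪ C, G.excess Q Q' ≤ 0 := by
    intro Q hQ Q' hQ'
    have h1 : G.edgesAcross Q Q' ≤ Q'.card := by
      rw [edgesAcross, Finset.sum_comm]
      calc _ ≤ ∑ s ∈ Q', (1 : ℤ) := Finset.sum_le_sum fun s hs => hpair Q hQ s (hBCW Q' hQ' hs)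
        _ = _ := by simp
    rw [excess, (b1 Q hQ).1.card_eq]
    push_cast
    linarith
  refine ⟨A, B, C, fun T hT => (a1 T hT).1, fun Q hQ => (b1 Q hQ).1, fun S hS => (c1 S hS).1,
    ?_, ?_, ?_⟩
  · intro P hP Q hQ hne
    rw [Finset.union_assoc] at hP hQ
    rcases Finset.mem_union.1 hP with hP | hP <;> rcases Finset.mem_union.1 hQ with hQ | hQ
    · exact a2 P hP Q hQ hne
    · exact Finset.disjoint_of_subset_right (hBCW Q hQ) (hAW P hP)
    · exact (Finset.disjoint_of_subset_right (hBCW P hP) (hAW Q hQ)).symm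
    · exact hBC P hP Q hQ hne
  · intro v
    by_contra! h
    have hv : v ∈ X \ C.biUnion id := by
      simp only [hX, hW, Finset.mem_sdiff, Finset.mem_univ, Finset.mem_biUnion, id, true_and,
        not_exists, not_and]
      exact ⟨⟨fun P hP => h P (by simp [hP]), fun P hP => h P (by simp [hP])⟩,
        fun P hP => h P (by simp [hP])⟩
    exact c3 {v} (by simpa using hv) ⟨by simp, by simp⟩
  · intro Q hQ Q' hQ' hne
    rcases Finset.mem_union.1 hQ with hQB | hQC
    · exact hexc Q hQB Q' hQ'
    rcases Finset.mem_union.1 hQ' with hQB' | hQC'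
    · rw [excess_comm]
      exact hexc Q' hQB' Q hQ
    · have h1 : G.edgesAcross Q Q' = 0 := Finset.sum_eq_zero fun u hu =>
        Finset.sum_eq_zero fun v hv => hedge u v ((c1 Q hQC).2 hu) ((c1 Q' hQC').2 hv)
      rw [excess, h1, (c1 Q hQC).1.card_eq, (c1 Q' hQC').1.card_eq]
      norm_num

namespace GreedyPartition

variable {A B C : Finset (Finset V)}

/-- The surplus of three distinct sets. -/
def distinctSurplus (G : SimpleGraph V) [DecidableRel G.Adj] (P Q R : Finset V) : ℤ :=
  if P = Q ∨ P = R ∨ Q = R then 0 else G.surplus P Q R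

theorem exists_eq_singleton (h : GreedyPartition G A B C) {S : Finset V} (hS : S ∈ C) :
    ∃ s, S = {s} := Finset.card_eq_one.1 (h.single S hS).card_eq

theorem surplus_nonneg (hK : G.CliqueFree 4) (h : GreedyPartition G A B C) {P Q R : Finset V}
    (hP : P ∈ A ∪ B ∪ C) (hQ : Q ∈ B ∪ C) (hR : R ∈ B ∪ C) (hPQ : P ≠ Q) (hPR : P ≠ R)
    (hQR : Q ≠ R) : 0 ≤ G.surplus P Q R := by
  have h0 := G.trianglesAcross_nonneg P Q R
  have h1 := h.excess_nonpos Q hQ R hR hQR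
  have of_nonpos (h2 : G.excess P Q ≤ 0) (h3 : G.excess P R ≤ 0) : 0 ≤ G.surplus P Q R := by
    rw [surplus]
    linarith
  rw [Finset.union_assoc] at hP
  rcases Finset.mem_union.1 hP with hP | hP
  · have hT := h.triangle P hP
    rcases Finset.mem_union.1 hQ with hQB | hQC <;> rcases Finset.mem_union.1 hR with hRB | hRC
    · exact surplus_triangle_pair_pair hK hT (h.edge Q hQB) (h.edge R hRB) h1
    · obtain ⟨s, rfl⟩ := h.exists_eq_singleton hRC
      exact surplus_triangle_pair_singleton hK hT (h.edge Q hQB) s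
    · obtain ⟨s, rfl⟩ := h.exists_eq_singleton hQC
      rw [surplus_swap_right]
      exact surplus_triangle_pair_singleton hK hT (h.edge R hRB) s
    · obtain ⟨s, rfl⟩ := h.exists_eq_singleton hRC
      obtain ⟨s', rfl⟩ := h.exists_eq_singleton hQC
      exact of_nonpos (excess_triangle_singleton hK hT _) (excess_triangle_singleton hK hT _)
  · exact of_nonpos (h.excess_nonpos P hP Q hQ hPQ) (h.excess_nonpos P hP R hR hPR)

theorem disjoint_left (h : GreedyPartition G A B C) : Disjoint A B :=
  Finset.disjoint_left.2 fun P hA hB => by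
    have h1 := (h.triangle P hA).card_eq
    have h2 := (h.edge P hB).card_eq
    lia

theorem disjoint_union_left (h : GreedyPartition G A B C) : Disjoint (A ∪ B) C :=
  Finset.disjoint_left.2 fun P hAB hC => by
    have h3 := (h.single P hC).card_eq
    rcases Finset.mem_union.1 hAB with hA | hB
    · have h1 := (h.triangle P hA).card_eq
      lia
    · have h2 := (h.edge P hB).card_eq
      lia

theorem compensated (hK : G.CliqueFree 4) (h : GreedyPartition G A B C) :
    Compensated A B C (distinctSurplus G) := by
  have hAB {P Q} (hP : P ∈ A) (hQ : Q ∈ B) : P ≠ Q :=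
    fun e => Finset.disjoint_left.1 h.disjoint_left hP (e ▸ hQ)
  have hAC {P Q} (hP : P ∈ A) (hQ : Q ∈ C) : P ≠ Q := fun e =>
    Finset.disjoint_left.1 h.disjoint_union_left (Finset.mem_union_left _ hP) (e ▸ hQ)
  have hBC {P Q} (hP : P ∈ B) (hQ : Q ∈ C) : P ≠ Q := fun e =>
    Finset.disjoint_left.1 h.disjoint_union_left (Finset.mem_union_right _ hP) (e ▸ hQ)
  refine ⟨?_, ?_, ?_, ?_, ?_, ?_, ?_, ?_⟩
  · intro P Q R
    simp only [distinctSurplus, surplus_swap_left P Q R]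
    congr 1
    grind
  · intro P Q R
    simp only [distinctSurplus, surplus_swap_right P Q R]
    congr 1
    grind
  · simp [distinctSurplus]
  · intro P hP Q hQ R hR
    unfold distinctSurplus
    split_ifs with h1
    · rfl
    · push Not at h1
      exact h.surplus_nonneg hK hP hQ hR h1.1 h1.2.1 h1.2.2
  · intro P hP Q hQ S hS
    unfold distinctSurplus
    split_ifs with h1
    · rfl
    · obtain ⟨s, rfl⟩ := h.exists_eq_singleton hS
      exact surplus_triangle_triangle_singleton hK (h.triangle P hP) (h.triangle Q hQ) s
  · intro P hP Q hQ R hR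
    by_cases h1 : P = Q ∨ P = R ∨ Q = R
    · left
      simp [distinctSurplus, h1]
    · obtain h2 | ⟨h2, h3⟩ :=
        surplus_triangles hK (h.triangle P hP) (h.triangle Q hQ) (h.triangle R hR)
      · left
        simpa [distinctSurplus, h1] using h2
      · right
        push Not at h1
        refine ⟨by simpa [distinctSurplus, h1] using h2, fun S hS => ?_⟩
        have hPS := hAC hP hS
        have hQS := hAC hQ hS
        have hRS := hAC hR hS
        obtain ⟨s, rfl⟩ := h.exists_eq_singleton hS
        simpa [distinctSurplus, h1, hPS, hQS, hRS] using h3 s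
  · intro P hP Q hQ R hR
    have hPR := hAB hP hR
    have hQR := hAB hQ hR
    by_cases h1 : P = Q
    · left
      simp [distinctSurplus, h1]
    · obtain h2 | ⟨h2, -⟩ := surplus_triangle_triangle_pair hK (h.triangle P hP)
        (h.triangle Q hQ) (h.edge R hR)
      · left
        simpa [distinctSurplus, h1, hPR, hQR] using h2
      · right
        refine ⟨by simpa [distinctSurplus, h1, hPR, hQR] using h2, fun S hS => ?_⟩
        have hPS := hAC hP hS
        have hQS := hAC hQ hS
        have hRS := hBC hR hS
        have hx := h.excess_nonpos R (by simp [hR]) S (by simp [hS]) hRS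
        obtain ⟨s, rfl⟩ := h.exists_eq_singleton hS
        simpa [distinctSurplus, hPR, hQR, hPS, hQS, hRS] using
          one_le_surplus_add_surplus_pair_singleton hK (h.triangle P hP) (h.triangle Q hQ)
            (h.edge R hR) (by lia) hx
  · intro P hP Q hQ R hR R' hR' h1 h2 hne
    have hPQ : P ≠ Q := by
      rintro rfl
      simp [distinctSurplus] at h1
    have hPR := hAB hP hR
    have hQR := hAB hQ hR
    have hPR' := hAB hP hR'
    have hQR' := hAB hQ hR'
    simp only [distinctSurplus, hPQ, hPR, hQR, hPR', hQR', hne, or_self, if_false] at h1 h2 ⊢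
    exact four_le_surplus_add_surplus_pair_pair hK (h.triangle P hP) (h.triangle Q hQ)
      (h.edge R hR) (h.edge R' hR') h1 h2

end GreedyPartition

theorem trianglesAcross_self_left {n : ℕ} {P : Finset V} (hP : G.IsNClique n P) (Q : Finset V) :
    G.trianglesAcross P P Q =
      ∑ w ∈ Q, (∑ u ∈ P, G.adjInt u w) * (∑ u ∈ P, G.adjInt u w - 1) := by
  have h1 : G.trianglesAcross P P Q =
      ∑ w ∈ Q, ∑ u ∈ P, ∑ v ∈ P, G.adjInt u v * G.adjInt u w * G.adjInt v w := by
    unfold trianglesAcross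
    simp only [Finset.sum_comm (s := P) (t := Q)]
  rw [h1]
  refine Finset.sum_congr rfl fun w _ => ?_
  have h2 (u) (hu : u ∈ P) : ∑ v ∈ P, G.adjInt u v * G.adjInt u w * G.adjInt v w =
      G.adjInt u w * ∑ v ∈ P, G.adjInt v w - G.adjInt u w := by
    have h3 (v) (hv : v ∈ P) : G.adjInt u v * G.adjInt u w * G.adjInt v w =
        G.adjInt u w * G.adjInt v w - if u = v then G.adjInt u w else 0 := by
      split_ifs with h
      · subst h
        rcases adjInt_eq_zero_or_one (G := G) u w with h | h <;> simp [adjInt_self, h]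
      · rw [adjInt_eq_one (hP.isClique hu hv h)]
        ring
    rw [Finset.sum_congr rfl h3, Finset.sum_sub_distrib, ← Finset.mul_sum, Finset.sum_ite_eq,
      if_pos hu]
  rw [Finset.sum_congr rfl h2, Finset.sum_sub_distrib, ← Finset.sum_mul]
  ring

theorem edgesAcross_self {n : ℕ} {P : Finset V} (hP : G.IsNClique n P) :
    G.edgesAcross P P = n * (n - 1) := by
  have h1 (u) (hu : u ∈ P) : ∑ v ∈ P, G.adjInt u v = (n : ℤ) - 1 := by
    have h2 (v) (hv : v ∈ P) : G.adjInt u v = if u = v then 0 else 1 := by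
      split_ifs with h
      · rw [h, adjInt_self]
      · exact adjInt_eq_one (hP.isClique hu hv h)
    rw [Finset.sum_congr rfl h2, card_sub_one_mul_sum hu, hP.card_eq, mul_one]
  rw [edgesAcross, Finset.sum_congr rfl h1, Finset.sum_const, nsmul_eq_mul, hP.card_eq]

theorem two_mul_edgesAcross_sub_card_le {n : ℕ} {P : Finset V} (hP : G.IsNClique n P)
    (Q : Finset V) : 2 * (G.edgesAcross P Q - Q.card) ≤ G.trianglesAcross P P Q := by
  rw [trianglesAcross_self_left hP, edgesAcross, Finset.sum_comm]
  have : (Q.card : ℤ) = ∑ w ∈ Q, 1 := by simp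
  rw [this, ← Finset.sum_sub_distrib, Finset.mul_sum]
  refine Finset.sum_le_sum fun w _ => ?_
  generalize ∑ u ∈ P, G.adjInt u w = d
  rcases le_or_gt d 1 with h | h <;> nlinarith

namespace GreedyPartition

variable {A B C : Finset (Finset V)}

theorem excess_le_trianglesAcross_add (h : GreedyPartition G A B C)
    {P Q : Finset V} (hP : P ∈ A ∪ B ∪ C) (hQ : Q ∈ A ∪ B ∪ C) (hne : P ≠ Q) :
    4 * G.excess P Q + 2 * ((if P ∈ A then 1 else 0) + if Q ∈ A then 1 else 0) ≤
      G.trianglesAcross P P Q + G.trianglesAcross Q Q P := by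
  have hBA {P} (hP : P ∈ B) : P ∉ A := fun h1 => Finset.disjoint_left.1 h.disjoint_left h1 hP
  have hCA {P} (hP : P ∈ C) : P ∉ A := fun h1 =>
    Finset.disjoint_left.1 h.disjoint_union_left (Finset.mem_union_left _ h1) hP
  have hn1 := G.trianglesAcross_nonneg P P Q
  have hn2 := G.trianglesAcross_nonneg Q Q P
  have single {P Q : Finset V} (hP : P ∈ A) (hQ : Q ∈ C) :
      4 * G.excess P Q + 2 ≤ G.trianglesAcross P P Q := by
    obtain ⟨s, rfl⟩ := h.exists_eq_singleton hQ
    rw [trianglesAcross_self_left (h.triangle P hP), excess, edgesAcross,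
      (h.triangle P hP).card_eq]
    simp only [Finset.sum_singleton, Finset.card_singleton]
    generalize ∑ u ∈ P, G.adjInt u s = d
    push_cast
    rcases le_or_gt d 2 with h | h <;> nlinarith
  have hex : G.excess P Q = G.edgesAcross P Q - P.card - Q.card + 2 := rfl
  have large {m n : ℕ} (hP : G.IsNClique m P) (hQ : G.IsNClique n Q) :
      4 * G.excess P Q + 2 * (m + n - 4) ≤
        G.trianglesAcross P P Q + G.trianglesAcross Q Q P := by
    have h1 := two_mul_edgesAcross_sub_card_le hP Q
    have h2 := two_mul_edgesAcross_sub_card_le hQ P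
    rw [edgesAcross_comm] at h2
    rw [hP.card_eq] at h2 hex
    rw [hQ.card_eq] at h1 hex
    linarith
  simp only [Finset.mem_union] at hP hQ
  rcases hP with (hP | hP) | hP <;> rcases hQ with (hQ | hQ) | hQ
  · have := large (h.triangle P hP) (h.triangle Q hQ)
    simp only [hP, hQ, if_true]
    lia
  · have := large (h.triangle P hP) (h.edge Q hQ)
    simp only [hP, hBA hQ, if_true, if_false]
    lia
  · have := single hP hQ
    simp only [hP, hCA hQ, if_true, if_false]
    lia
  · have := large (h.edge P hP) (h.triangle Q hQ)
    simp only [hBA hP, hQ, if_true, if_false]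
    lia
  · have := large (h.edge P hP) (h.edge Q hQ)
    simp only [hBA hP, hBA hQ, if_false]
    lia
  · have := h.excess_nonpos P (by simp [hP]) Q (by simp [hQ]) hne
    simp only [hBA hP, hCA hQ, if_false]
    lia
  · have := single hQ hP
    rw [excess_comm] at this
    simp only [hCA hP, hQ, if_true, if_false]
    lia
  · have := h.excess_nonpos P (by simp [hP]) Q (by simp [hQ]) hne
    simp only [hCA hP, hBA hQ, if_false]
    lia
  · have := h.excess_nonpos P (by simp [hP]) Q (by simp [hQ]) hne
    simp only [hCA hP, hCA hQ, if_false]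
    lia

theorem six_mul_le_sum_trianglesAcross_self (h : GreedyPartition G A B C) :
    6 * (A.card : ℤ) ≤ ∑ P ∈ A ∪ B ∪ C, G.trianglesAcross P P P := by
  have h1 : ∑ P ∈ A, (6 : ℤ) ≤ ∑ P ∈ A, G.trianglesAcross P P P := by
    refine Finset.sum_le_sum fun P hP => ?_
    have h2 := two_mul_edgesAcross_sub_card_le (h.triangle P hP) P
    rw [edgesAcross_self (h.triangle P hP), (h.triangle P hP).card_eq] at h2
    push_cast at h2
    linarith
  have h3 : ∑ P ∈ A, G.trianglesAcross P P P ≤ ∑ P ∈ A ∪ B ∪ C, G.trianglesAcross P P P :=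
    Finset.sum_le_sum_of_subset_of_nonneg
      (Finset.subset_union_left.trans Finset.subset_union_left)
      fun P _ _ => G.trianglesAcross_nonneg P P P
  simp only [Finset.sum_const, nsmul_eq_mul] at h1
  linarith

theorem card_eq (h : GreedyPartition G A B C) :
    (A ∪ B ∪ C).card = A.card + B.card + C.card := by
  rw [Finset.card_union_of_disjoint h.disjoint_union_left,
    Finset.card_union_of_disjoint h.disjoint_left]

theorem sum_eq (h : GreedyPartition G A B C) (f : Finset V → ℤ) :
    ∑ P ∈ A ∪ B ∪ C, f P = ∑ P ∈ A, f P + ∑ P ∈ B, f P + ∑ P ∈ C, f P := by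
  rw [Finset.sum_union h.disjoint_union_left, Finset.sum_union h.disjoint_left]

theorem sum_univ_eq [Fintype V] (h : GreedyPartition G A B C) (f : V → ℤ) :
    ∑ v, f v = ∑ P ∈ A ∪ B ∪ C, ∑ v ∈ P, f v := by
  have h1 : (Finset.univ : Finset V) = (A ∪ B ∪ C).biUnion id := by
    ext v
    simpa using h.cover v
  rw [h1, Finset.sum_biUnion]
  · rfl
  · exact fun P hP Q hQ hne => h.disjoint P hP Q hQ hne

theorem sum_card (h : GreedyPartition G A B C) :
    ∑ P ∈ A ∪ B ∪ C, (P.card : ℤ) = 3 * A.card + 2 * B.card + C.card := by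
  rw [h.sum_eq, Finset.sum_congr rfl fun P hP => by rw [(h.triangle P hP).card_eq],
    Finset.sum_congr (s₁ := B) rfl fun P hP => by rw [(h.edge P hP).card_eq],
    Finset.sum_congr (s₁ := C) rfl fun P hP => by rw [(h.single P hP).card_eq]]
  simp
  ring

theorem card_univ_eq [Fintype V] (h : GreedyPartition G A B C) :
    (Fintype.card V : ℤ) = 3 * A.card + 2 * B.card + C.card := by
  have h1 := h.sum_univ_eq fun _ => 1
  simpa only [Finset.sum_const, nsmul_eq_mul, mul_one, Finset.card_univ, h.sum_card] using h1

theorem sum_edgesAcross_self (h : GreedyPartition G A B C) :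
    ∑ P ∈ A ∪ B ∪ C, G.edgesAcross P P = 6 * A.card + 2 * B.card := by
  rw [h.sum_eq, Finset.sum_congr rfl fun P hP => edgesAcross_self (h.triangle P hP),
    Finset.sum_congr (s₁ := B) rfl fun P hP => edgesAcross_self (h.edge P hP),
    Finset.sum_congr (s₁ := C) rfl fun P hP => edgesAcross_self (h.single P hP)]
  simp
  ring

end GreedyPartition

theorem sum_eq_sum_distinct_add {α : Type*} [DecidableEq α] (U : Finset α) (f : α → α → α → ℤ)
    (swap_left : ∀ p q r, f p q r = f q p r) (swap_right : ∀ p q r, f p q r = f p r q) :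
    ∑ p ∈ U, ∑ q ∈ U, ∑ r ∈ U, f p q r =
      ∑ p ∈ U, ∑ q ∈ U, ∑ r ∈ U, (if p = q ∨ p = r ∨ q = r then 0 else f p q r) +
        3 * ∑ p ∈ U, ∑ q ∈ U, (if p = q then 0 else f p p q) + ∑ p ∈ U, f p p p := by
  set g : α → α → ℤ := fun p q => if p = q then 0 else f p p q with hg
  have h1 (p q r) : f p q r = (if p = q ∨ p = r ∨ q = r then 0 else f p q r) +
      (if p = q then g p r else 0) + (if p = r then g p q else 0) + (if q = r then g q p else 0) +
      if p = q then if p = r then f p p p else 0 else 0 := by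
    by_cases hpq : p = q
    · subst hpq
      by_cases hpr : p = r
      · subst hpr; simp [hg]
      · simp [hg, hpr]
    · by_cases hpr : p = r
      · subst hpr
        simp [hg, hpq, Ne.symm hpq, swap_right p q p]
      · by_cases hqr : q = r
        · subst hqr
          simp [hg, hpq, Ne.symm hpq, swap_left p q q, swap_right q p q]
        · simp [hpq, hpr, hqr]
  have e1 : ∑ p ∈ U, ∑ q ∈ U, ∑ r ∈ U, (if p = q then g p r else 0) =
      ∑ p ∈ U, ∑ q ∈ U, g p q := by
    refine Finset.sum_congr rfl fun p hp => ?_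
    rw [Finset.sum_comm]
    simp [hp]
  have e2 : ∑ p ∈ U, ∑ q ∈ U, ∑ r ∈ U, (if p = r then g p q else 0) =
      ∑ p ∈ U, ∑ q ∈ U, g p q := by
    refine Finset.sum_congr rfl fun p hp => ?_
    simp [hp]
  have e3 : ∑ p ∈ U, ∑ q ∈ U, ∑ r ∈ U, (if q = r then g q p else 0) =
      ∑ p ∈ U, ∑ q ∈ U, g p q := by
    rw [Finset.sum_comm]
    exact Finset.sum_congr rfl fun q hq => by simp [hq]
  have e4 : ∑ p ∈ U, ∑ q ∈ U, ∑ r ∈ U, (if p = q then if p = r then f p p p else 0 else 0) =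
      ∑ p ∈ U, f p p p := by
    refine Finset.sum_congr rfl fun p hp => ?_
    rw [Finset.sum_comm]
    simp [hp]
  rw [Finset.sum_congr rfl fun p _ => Finset.sum_congr rfl fun q _ => Finset.sum_congr rfl
    fun r _ => h1 p q r]
  simp only [Finset.sum_add_distrib]
  rw [e1, e2, e3, e4]
  ring

namespace GreedyPartition

variable {A B C : Finset (Finset V)}

theorem sum_distinctSurplus (U : Finset (Finset V)) :
    ∑ P ∈ U, ∑ Q ∈ U, ∑ R ∈ U, distinctSurplus G P Q R =
      ∑ P ∈ U, ∑ Q ∈ U, ∑ R ∈ U,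
        (if P = Q ∨ P = R ∨ Q = R then 0 else G.trianglesAcross P Q R) -
      3 * ((U.card - 2) * ∑ P ∈ U, ∑ Q ∈ U, if P = Q then 0 else G.excess P Q) := by
  set x : Finset V → Finset V → ℤ := fun P Q => if P = Q then 0 else G.excess P Q with hx
  have h1 (P Q R) : distinctSurplus G P Q R =
      (if P = Q ∨ P = R ∨ Q = R then 0 else G.trianglesAcross P Q R) -
      (if R = P ∨ R = Q then 0 else x P Q) - (if Q = P ∨ Q = R then 0 else x P R) -
      (if P = Q ∨ P = R then 0 else x Q R) := by
    simp only [distinctSurplus, surplus, hx]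
    grind
  have e1 : ∑ P ∈ U, ∑ Q ∈ U, ∑ R ∈ U, (if R = P ∨ R = Q then 0 else x P Q) =
      (U.card - 2) * ∑ P ∈ U, ∑ Q ∈ U, x P Q := by
    simp only [Finset.mul_sum]
    exact Finset.sum_congr rfl fun P hP => Finset.sum_congr rfl fun Q hQ =>
      card_sub_two_mul_sum hP hQ _ fun h => by simp [hx, h]
  have e2 : ∑ P ∈ U, ∑ Q ∈ U, ∑ R ∈ U, (if Q = P ∨ Q = R then 0 else x P R) =
      (U.card - 2) * ∑ P ∈ U, ∑ Q ∈ U, x P Q := by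
    rw [← e1]
    exact Finset.sum_congr rfl fun P hP => Finset.sum_comm
  have e3 : ∑ P ∈ U, ∑ Q ∈ U, ∑ R ∈ U, (if P = Q ∨ P = R then 0 else x Q R) =
      (U.card - 2) * ∑ P ∈ U, ∑ Q ∈ U, x P Q := by
    rw [← e2, Finset.sum_comm]
  simp only [h1, Finset.sum_sub_distrib]
  rw [e1, e2, e3]
  ring

theorem sum_adjInt_mul_eq [Fintype V] (h : GreedyPartition G A B C) :
    ∑ u, ∑ v, ∑ w, G.adjInt u v * G.adjInt u w * G.adjInt v w =
      ∑ P ∈ A ∪ B ∪ C, ∑ Q ∈ A ∪ B ∪ C, ∑ R ∈ A ∪ B ∪ C, G.trianglesAcross P Q R := by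
  simp only [h.sum_univ_eq, trianglesAcross]
  refine Finset.sum_congr rfl fun P _ => ?_
  rw [Finset.sum_comm]
  refine Finset.sum_congr rfl fun Q _ => ?_
  simp only [Finset.sum_comm (s := Q) (t := A ∪ B ∪ C), Finset.sum_comm (s := P) (t := A ∪ B ∪ C)]

theorem sum_adjInt_eq [Fintype V] (h : GreedyPartition G A B C) :
    ∑ u, ∑ v, G.adjInt u v = ∑ P ∈ A ∪ B ∪ C, ∑ Q ∈ A ∪ B ∪ C, G.edgesAcross P Q := by
  simp only [h.sum_univ_eq, edgesAcross]
  exact Finset.sum_congr rfl fun P _ => Finset.sum_comm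

theorem sum_edgesAcross (U : Finset (Finset V)) :
    ∑ P ∈ U, ∑ Q ∈ U, G.edgesAcross P Q =
      ∑ P ∈ U, ∑ Q ∈ U, (if P = Q then 0 else G.excess P Q) +
      2 * (U.card - 1) * ∑ P ∈ U, ((P.card : ℤ) - 1) +
      ∑ P ∈ U, G.edgesAcross P P := by
  rw [← Compensated.sum_sum_ite_add]
  have h1 (P Q) : G.edgesAcross P Q = (if P = Q then 0 else G.excess P Q) +
      ((if P = Q then 0 else ((P.card : ℤ) - 1)) + if P = Q then 0 else ((Q.card : ℤ) - 1)) +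
      if P = Q then G.edgesAcross P P else 0 := by
    split_ifs with hPQ
    · simp [hPQ]
    · rw [excess]; ring
  rw [Finset.sum_congr rfl fun P _ => Finset.sum_congr rfl fun Q _ => h1 P Q]
  simp only [Finset.sum_add_distrib, Finset.sum_ite_eq]
  simp +contextual

theorem le_sum_trianglesAcross_self (h : GreedyPartition G A B C) :
    2 * ∑ P ∈ A ∪ B ∪ C, ∑ Q ∈ A ∪ B ∪ C, (if P = Q then 0 else G.excess P Q) +
      2 * ((A ∪ B ∪ C).card - 1) * A.card ≤
      ∑ P ∈ A ∪ B ∪ C, ∑ Q ∈ A ∪ B ∪ C, (if P = Q then 0 else G.trianglesAcross P P Q) := by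
  have h1 : ∑ P ∈ A ∪ B ∪ C, (if P ∈ A then 1 else 0 : ℤ) = A.card := by
    simp [Finset.sum_ite_mem]
  have h2 := Compensated.sum_sum_ite_add (A := A ∪ B ∪ C)
    (fun P => if P ∈ A then (1 : ℤ) else 0)
  rw [h1] at h2
  have h3 : ∑ P ∈ A ∪ B ∪ C, ∑ Q ∈ A ∪ B ∪ C, (if P = Q then 0 else G.trianglesAcross P P Q) =
      ∑ P ∈ A ∪ B ∪ C, ∑ Q ∈ A ∪ B ∪ C, (if P = Q then 0 else G.trianglesAcross Q Q P) := by
    rw [Finset.sum_comm]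
    simp only [eq_comm]
  have h4 : ∑ P ∈ A ∪ B ∪ C, ∑ Q ∈ A ∪ B ∪ C, (4 * (if P = Q then 0 else G.excess P Q) +
      2 * ((if P = Q then 0 else if P ∈ A then 1 else 0) +
        if P = Q then 0 else if Q ∈ A then 1 else 0)) ≤
      ∑ P ∈ A ∪ B ∪ C, ∑ Q ∈ A ∪ B ∪ C, ((if P = Q then 0 else G.trianglesAcross P P Q) +
        if P = Q then 0 else G.trianglesAcross Q Q P) := by
    refine Finset.sum_le_sum fun P hP => Finset.sum_le_sum fun Q hQ => ?_
    by_cases hPQ : P = Q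
    · simp [hPQ]
    · simpa only [hPQ, if_false] using h.excess_le_trianglesAcross_add hP hQ hPQ
  simp only [Finset.sum_add_distrib, ← Finset.mul_sum] at h4 h2
  rw [h2, ← h3] at h4
  linarith

theorem three_mul_card_mul_le [Fintype V] (hK : G.CliqueFree 4) (h : GreedyPartition G A B C) :
    3 * (A ∪ B ∪ C).card * (2 * ∑ u, ∑ v, G.adjInt u v - (Fintype.card V : ℤ) ^ 2) ≤
      2 * ∑ u, ∑ v, ∑ w, G.adjInt u v * G.adjInt u w * G.adjInt v w := by
  have h1 := (h.compensated hK).card_mul_sq_le_sum h.disjoint_left h.disjoint_union_left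
  have h2 := h.le_sum_trianglesAcross_self
  have h3 := h.six_mul_le_sum_trianglesAcross_self
  have h4 := h.card_eq
  rw [sum_distinctSurplus] at h1
  rw [h.sum_adjInt_mul_eq, h.sum_adjInt_eq, sum_edgesAcross, h.sum_edgesAcross_self,
    sum_eq_sum_distinct_add _ _ trianglesAcross_swap_left trianglesAcross_swap_right,
    Finset.sum_sub_distrib, h.sum_card, h.card_univ_eq]
  simp only [Finset.sum_const, nsmul_eq_mul, mul_one, h4] at *
  generalize (∑ P ∈ A ∪ B ∪ C, ∑ Q ∈ A ∪ B ∪ C, if P = Q then 0 else G.excess P Q) = X at *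
  generalize (∑ P ∈ A ∪ B ∪ C, ∑ Q ∈ A ∪ B ∪ C, if P = Q then 0 else G.trianglesAcross P P Q) = Y
    at *
  generalize ∑ P ∈ A ∪ B ∪ C, G.trianglesAcross P P P = Z at *
  push_cast at *
  have ha : (0 : ℤ) ≤ A.card := by positivity
  have hb : (0 : ℤ) ≤ B.card := by positivity
  have hc : (0 : ℤ) ≤ C.card := by positivity
  generalize (A.card : ℤ) = a at *
  generalize (B.card : ℤ) = b at *
  generalize (C.card : ℤ) = c at *
  have h5 : 0 ≤ (b + c) * (a - c) ^ 2 := by positivity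
  nlinarith

end GreedyPartition

theorem sum_adjInt_eq_four_mul_card [Fintype V] :
    2 * ∑ u, ∑ v, G.adjInt u v = 4 * (G.edgeFinset.card : ℤ) := by
  have h1 (u : V) : ∑ v, G.adjInt u v = G.degree u := by
    simp [adjInt, Finset.sum_boole, degree, neighborFinset_eq_filter]
  have h2 := G.sum_degrees_eq_twice_card_edges
  simp only [h1]
  rw [← Nat.cast_sum, h2]
  push_cast
  ring

theorem sum_adjInt_mul_le [Fintype V] :
    ∑ u, ∑ v, ∑ w, G.adjInt u v * G.adjInt u w * G.adjInt v w ≤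
      6 * ((G.cliqueFinset 3).card : ℤ) := by
  set s : Finset (V × V × V) :=
    {t | G.Adj t.1 t.2.1 ∧ G.Adj t.1 t.2.2 ∧ G.Adj t.2.1 t.2.2} with hs
  have h1 : ∑ u, ∑ v, ∑ w, G.adjInt u v * G.adjInt u w * G.adjInt v w = s.card := by
    rw [hs, Finset.card_filter, Fintype.sum_prod_type]
    push_cast
    refine Finset.sum_congr rfl fun u _ => ?_
    rw [Fintype.sum_prod_type]
    refine Finset.sum_congr rfl fun v _ => Finset.sum_congr rfl fun w _ => ?_
    simp only [adjInt]
    grind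
  rw [h1]
  norm_cast
  refine Finset.card_le_mul_card_image_of_maps_to
    (f := fun t : V × V × V => ({t.1, t.2.1, t.2.2} : Finset V)) ?_ 6 ?_
  · intro t ht
    simpa [hs, is3Clique_triple_iff] using ht
  · intro T hT
    rw [mem_cliqueFinset_iff] at hT
    obtain ⟨a, b, c, hab, hac, hbc, rfl⟩ := Finset.card_eq_three.1 hT.card_eq
    refine (Finset.card_le_card (t := {(a, b, c), (a, c, b), (b, a, c), (b, c, a), (c, a, b),
      (c, b, a)}) ?_).trans Finset.card_le_six
    rintro ⟨u, v, w⟩ ht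
    simp only [hs, Finset.mem_filter, Finset.mem_univ, true_and] at ht
    obtain ⟨⟨huv, huw, hvw⟩, ht⟩ := ht
    have hu : u ∈ ({a, b, c} : Finset V) := by simp [← ht]
    have hv : v ∈ ({a, b, c} : Finset V) := by simp [← ht]
    have hw : w ∈ ({a, b, c} : Finset V) := by simp [← ht]
    have := huv.ne
    have := huw.ne
    have := hvw.ne
    simp only [Finset.mem_insert, Finset.mem_singleton, Prod.mk.injEq] at hu hv hw ⊢
    grind

/-- If the vertices are covered by `r` cliques of a `K₄`-free graph, then its triangles split into
`r` edge-disjoint families. -/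
theorem exists_edgeDisjoint_triangles [Fintype V] (hK : G.CliqueFree 4) {U : Finset (Finset V)}
    (clique : ∀ P ∈ U, G.IsClique P) (cover : ∀ v, ∃ P ∈ U, v ∈ P) {k : ℕ} (hU : U.Nonempty)
    (hk : U.card * k ≤ (G.cliqueFinset 3).card) :
    ∃ S : Finset (Finset V), S.card = k ∧ (∀ T ∈ S, G.IsNClique 3 T) ∧
      ∀ T₁ ∈ S, ∀ T₂ ∈ S, T₁ ≠ T₂ → (T₁ ∩ T₂).card ≤ 1 := by
  choose part part_mem mem_part using cover
  set label : V → ℕ := fun v => U.equivFin ⟨part v, part_mem v⟩ with hlabel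
  have label_lt (v) : label v < U.card := (U.equivFin ⟨part v, part_mem v⟩).2
  have adj_of_label {c d : V} (hcd : c ≠ d) (h : label c = label d) : G.Adj c d := by
    have h1 : part c = part d := by simpa using U.equivFin.injective (Fin.ext h)
    exact clique _ (part_mem c) (mem_part c) (by simpa [h1] using mem_part d) hcd
  obtain ⟨i, -, hi⟩ := Finset.exists_le_card_fiber_of_mul_le_card_of_maps_to
    (s := G.cliqueFinset 3) (t := Finset.range U.card) (n := k)
    (f := fun T => (∑ v ∈ T, label v) % U.card)
    (fun T _ => Finset.mem_range.2 (Nat.mod_lt _ hU.card_pos))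
    (by simpa using hU.card_pos.ne') (by simpa using hk)
  obtain ⟨S, hS, hSk⟩ := Finset.exists_subset_card_eq hi
  have hS' {T} (hT : T ∈ S) : G.IsNClique 3 T ∧ (∑ v ∈ T, label v) % U.card = i := by
    simpa [mem_cliqueFinset_iff] using hS hT
  refine ⟨S, hSk, fun T hT => (hS' hT).1, fun T₁ hT₁ T₂ hT₂ hne => ?_⟩
  by_contra! hcard
  obtain ⟨a, ha, b, hb, hab⟩ := Finset.one_lt_card.1 hcard
  rw [Finset.mem_inter] at ha hb
  obtain ⟨h₁, s₁⟩ := hS' hT₁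
  obtain ⟨h₂, s₂⟩ := hS' hT₂
  have c₁ := Finset.card_inter_add_card_sdiff T₁ T₂
  have c₂ := Finset.card_inter_add_card_sdiff T₂ T₁
  rw [Finset.inter_comm, h₂.card_eq] at c₂
  rw [h₁.card_eq] at c₁
  have c₃ : (T₁ \ T₂).card ≠ 0 := fun h => hne <| Finset.eq_of_subset_of_card_le
    (Finset.sdiff_eq_empty_iff_subset.1 (Finset.card_eq_zero.1 h))
    (by simp [h₁.card_eq, h₂.card_eq])
  obtain ⟨c, hc⟩ := Finset.card_eq_one.1 (show (T₁ \ T₂).card = 1 by lia)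
  obtain ⟨d, hd⟩ := Finset.card_eq_one.1 (show (T₂ \ T₁).card = 1 by lia)
  have hc' : c ∈ T₁ ∧ c ∉ T₂ := Finset.mem_sdiff.1 (by simp [hc])
  have hd' : d ∈ T₂ ∧ d ∉ T₁ := Finset.mem_sdiff.1 (by simp [hd])
  have hcd : label c = label d := by
    rw [← Finset.sum_inter_add_sum_sdiff T₁ T₂, hc, Finset.sum_singleton] at s₁
    rw [← Finset.sum_inter_add_sum_sdiff T₂ T₁, hd, Finset.sum_singleton, Finset.inter_comm,
      ← s₁] at s₂
    exact (Nat.ModEq.add_left_cancel' _ s₂.symm).eq_of_lt_of_lt (label_lt c) (label_lt d)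
  have ne_of {x y : V} {T : Finset V} (hx : x ∈ T) (hy : y ∉ T) : x ≠ y := fun h => hy (h ▸ hx)
  exact not_adj_of_cliqueFree_four hK (h₁.isClique ha.1 hb.1 hab)
    (h₁.isClique ha.1 hc'.1 (ne_of ha.2 hc'.2)) (h₂.isClique ha.2 hd'.1 (ne_of ha.1 hd'.2))
    (h₁.isClique hb.1 hc'.1 (ne_of hb.2 hc'.2)) (h₂.isClique hb.2 hd'.1 (ne_of hb.1 hd'.2))
    (adj_of_label (ne_of hc'.1 hd'.2) hcd)

theorem GreedyPartition.isClique {A B C : Finset (Finset V)} (h : GreedyPartition G A B C)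
    {P : Finset V} (hP : P ∈ A ∪ B ∪ C) : G.IsClique P := by
  simp only [Finset.mem_union] at hP
  rcases hP with (hP | hP) | hP
  · exact (h.triangle P hP).isClique
  · exact (h.edge P hP).isClique
  · exact (h.single P hP).isClique

theorem GreedyPartition.card_mul_le [Fintype V] {A B C : Finset (Finset V)}
    (h : GreedyPartition G A B C) (hK : G.CliqueFree 4) {k : ℕ}
    (hE : Fintype.card V ^ 2 + 4 * k ≤ 4 * G.edgeFinset.card) :
    (A ∪ B ∪ C).card * k ≤ (G.cliqueFinset 3).card := by
  have h1 := h.three_mul_card_mul_le hK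
  have h2 := G.sum_adjInt_mul_le
  rw [sum_adjInt_eq_four_mul_card] at h1
  zify at hE ⊢
  have h3 : (0 : ℤ) ≤ (A ∪ B ∪ C).card := by positivity
  nlinarith

end SimpleGraph

/-- Every K₄-free simple graph `G` on `n` vertices with at least
`n²/4 + k` edges (i.e. `4·|E(G)| ≥ n² + 4k`) contains `k` pairwise edge-disjoint
triangles. -/
theorem k4_free_edge_disjoint_triangles
    {V : Type*} [Fintype V] [DecidableEq V]
    (G : SimpleGraph V) [DecidableRel G.Adj] (k : ℕ)
    (hK4 : G.CliqueFree 4)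
    (hE : Fintype.card V ^ 2 + 4 * k ≤ 4 * G.edgeFinset.card) :
    ∃ S : Finset (Finset V),
      S.card = k ∧
      (∀ T ∈ S, G.IsNClique 3 T) ∧
      (∀ T₁ ∈ S, ∀ T₂ ∈ S, T₁ ≠ T₂ → (T₁ ∩ T₂).card ≤ 1) := by
  obtain ⟨A, B, C, h⟩ := G.exists_greedyPartition
  rcases (A ∪ B ∪ C).eq_empty_or_nonempty with hU | hU
  · have hV : IsEmpty V := ⟨fun v => by
      obtain ⟨P, hP, -⟩ := h.cover v
      simp [hU] at hP⟩
    have hk : k = 0 := by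
      have : G.edgeFinset.card = 0 := by simp [Subsingleton.elim G ⊥]
      lia
    exact ⟨∅, by simp [hk], by simp, by simp⟩
  · exact SimpleGraph.exists_edgeDisjoint_triangles hK4 (fun P hP => h.isClique hP) h.cover hU
      (h.card_mul_le hK4 hE)
end

section
/- Let G be a K₄-free simple graph, let t denote the total number of triangles of G, and let P be a greedy partition of G of size r. Then G contains a family of pairwise edge-disjoint triangles of cardinality at least t/r; equivalently, r times the maximum number of pairwise edge-disjoint triangles of G is at least t. -/
/-- A good partition of `G`: a partition of the vertex set into nonempty parts,
each inducing a clique; it is greedy if for every `l ≥ 1` the union of all parts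
of size at most `l` spans no complete subgraph on `l+1` vertices. -/
def IsGreedyPartition {V : Type*} [Fintype V] [DecidableEq V]
    (G : SimpleGraph V) (P : Finset (Finset V)) : Prop :=
  (∀ C ∈ P, C.Nonempty) ∧
  (∀ C ∈ P, G.IsClique (C : Set V)) ∧
  (∀ v : V, ∃! C, C ∈ P ∧ v ∈ C) ∧
  (∀ l : ℕ, 1 ≤ l → ∀ s : Finset V,
    (∀ v ∈ s, ∃ C ∈ P, v ∈ C ∧ C.card ≤ l) → ¬ G.IsNClique (l + 1) s)

/-- In a `K₄`-free graph, distinct triangles of equal label sum share at most one vertex, as soon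
as distinct vertices with the same label are adjacent. -/
theorem card_inter_le_one_of_sum_eq {V A : Type*} [DecidableEq V] [AddCommGroup A]
    {G : SimpleGraph V} (hK4 : G.CliqueFree 4) (f : V → A)
    (hf : ∀ v w, f v = f w → v ≠ w → G.Adj v w) {T₁ T₂ : Finset V}
    (h₁ : G.IsNClique 3 T₁) (h₂ : G.IsNClique 3 T₂) (hne : T₁ ≠ T₂)
    (hsum : ∑ v ∈ T₁, f v = ∑ v ∈ T₂, f v) : (T₁ ∩ T₂).card ≤ 1 := by
  by_contra! hlt
  have hcard₁ := Finset.card_inter_add_card_sdiff T₁ T₂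
  have hcard₂ := Finset.card_inter_add_card_sdiff T₂ T₁
  have hcomm := Finset.inter_comm T₂ T₁
  rw [hcomm, h₂.card_eq] at hcard₂
  rw [h₁.card_eq] at hcard₁
  have hinter : (T₁ ∩ T₂).card ≠ 3 := fun h => hne <|
    (Finset.eq_of_subset_of_card_le Finset.inter_subset_left (by rw [h, h₁.card_eq])).symm.trans
      (Finset.eq_of_subset_of_card_le Finset.inter_subset_right (by rw [h, h₂.card_eq]))
  obtain ⟨v, hv⟩ := Finset.card_eq_one.mp (show (T₁ \ T₂).card = 1 by omega)
  obtain ⟨w, hw⟩ := Finset.card_eq_one.mp (show (T₂ \ T₁).card = 1 by omega)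
  have hv' := Finset.mem_sdiff.mp (hv ▸ Finset.mem_singleton_self v)
  have hw' := Finset.mem_sdiff.mp (hw ▸ Finset.mem_singleton_self w)
  rw [← Finset.sum_inter_add_sum_sdiff T₁ T₂, ← Finset.sum_inter_add_sum_sdiff T₂ T₁, hcomm, hv, hw,
    Finset.sum_singleton, Finset.sum_singleton] at hsum
  have hwv : G.Adj w v :=
    hf w v (add_left_cancel hsum).symm (fun h => hw'.2 (h ▸ hv'.1))
  refine hK4 _ (h₁.insert (a := w) fun b hb => ?_)
  by_cases hb₂ : b ∈ T₂
  · exact h₂.isClique hw'.1 hb₂ (fun h => hw'.2 (h ▸ hb))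
  · have hbv : b ∈ T₁ \ T₂ := Finset.mem_sdiff.mpr ⟨hb, hb₂⟩
    rw [hv, Finset.mem_singleton] at hbv
    exact hbv ▸ hwv

/-- If `G` is `K₄`-free, `t` is the number of triangles of `G` and
`P` is a greedy partition of `G` of size `r`, then `G` contains a family of
pairwise edge-disjoint triangles of cardinality at least `t / r`. -/
theorem edge_disjoint_triangles_ge_triangles_div_greedy_size
    {V : Type*} [Fintype V] [DecidableEq V]
    (G : SimpleGraph V) [DecidableRel G.Adj]
    (hK4 : G.CliqueFree 4)
    (P : Finset (Finset V)) (hP : IsGreedyPartition G P) :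
    ∃ S : Finset (Finset V),
      (∀ T ∈ S, G.IsNClique 3 T) ∧
      (∀ T₁ ∈ S, ∀ T₂ ∈ S, T₁ ≠ T₂ → (T₁ ∩ T₂).card ≤ 1) ∧
      (G.cliqueFinset 3).card ≤ P.card * S.card := by
  obtain ⟨-, hclique, hpart, -⟩ := hP
  rcases P.eq_empty_or_nonempty with rfl | hne
  · have : IsEmpty V := ⟨fun v => by simpa using (hpart v).exists⟩
    refine ⟨∅, by simp, by simp, ?_⟩
    have hfree : G.CliqueFree 3 := fun T hT => by
      simpa [Finset.eq_empty_of_isEmpty T] using hT.card_eq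
    simp [SimpleGraph.cliqueFinset_eq_empty_iff.mpr hfree]
  have : NeZero P.card := ⟨hne.card_pos.ne'⟩
  choose part hmem using fun v => (hpart v).exists
  let e : P ≃ ZMod P.card := Fintype.equivOfCardEq (by simp [ZMod.card])
  let f : V → ZMod P.card := fun v => e ⟨part v, (hmem v).1⟩
  have hf : ∀ v w, f v = f w → v ≠ w → G.Adj v w := fun v w h hvw => by
    have hvw' : part v = part w := congrArg Subtype.val (e.injective h)
    exact hclique _ (hmem v).1 (hmem v).2 (hvw' ▸ (hmem w).2) hvw
  let colorClass : ZMod P.card → Finset (Finset V) :=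
    fun c => {T ∈ G.cliqueFinset 3 | ∑ v ∈ T, f v = c}
  obtain ⟨c, -, hc⟩ := Finset.exists_max_image Finset.univ (fun c => (colorClass c).card)
    Finset.univ_nonempty
  have hclass : ∀ T ∈ colorClass c, G.IsNClique 3 T ∧ ∑ v ∈ T, f v = c := fun T hT => by
    simpa [colorClass, SimpleGraph.mem_cliqueFinset_iff] using hT
  refine ⟨colorClass c, fun T hT => (hclass T hT).1, fun T₁ h₁ T₂ h₂ hT => ?_, ?_⟩
  · exact card_inter_le_one_of_sum_eq hK4 f hf (hclass T₁ h₁).1 (hclass T₂ h₂).1 hT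
      ((hclass T₁ h₁).2.trans (hclass T₂ h₂).2.symm)
  · have hle := Finset.card_le_mul_card_image_of_maps_to (s := G.cliqueFinset 3)
      (f := fun T => ∑ v ∈ T, f v) (t := Finset.univ) (fun _ _ => Finset.mem_univ _)
      (colorClass c).card hc
    rwa [Finset.card_univ, ZMod.card, mul_comm] at hle
end

section
/- Let G be a simple graph on n vertices with e edges and t triangles, and let P be a greedy partition of G of size r. Then t ≥ r·(e − n²/4); equivalently, as integers, 4t ≥ r·(4e − n²). -/
open Finset

namespace SimpleGraph

section Counting

variable {V : Type*}

/-- The integer-valued indicator of adjacency. -/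
noncomputable def adjInd (H : SimpleGraph V) (u v : V) : ℤ :=
  open Classical in if H.Adj u v then 1 else 0

/-- The number of ordered adjacent pairs in `S`. -/
noncomputable def edgeSum (H : SimpleGraph V) (S : Finset V) : ℤ :=
  ∑ u ∈ S, ∑ v ∈ S, H.adjInd u v

/-- The number of ordered triangles in `S`. -/
noncomputable def triangleSum (H : SimpleGraph V) (S : Finset V) : ℤ :=
  ∑ u ∈ S, ∑ v ∈ S, ∑ w ∈ S, H.adjInd u v * H.adjInd v w * H.adjInd u w

lemma adjInd_of_adj {H : SimpleGraph V} {u v : V} (h : H.Adj u v) : H.adjInd u v = 1 :=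
  if_pos h

lemma adjInd_of_not_adj {H : SimpleGraph V} {u v : V} (h : ¬ H.Adj u v) : H.adjInd u v = 0 :=
  if_neg h

lemma adjInd_nonneg (H : SimpleGraph V) (u v : V) : 0 ≤ H.adjInd u v := by
  unfold adjInd; split_ifs <;> simp

lemma edgeSum_nonneg (H : SimpleGraph V) (S : Finset V) : 0 ≤ H.edgeSum S :=
  sum_nonneg fun _ _ => sum_nonneg fun _ _ => H.adjInd_nonneg _ _

lemma triangleSum_nonneg (H : SimpleGraph V) (S : Finset V) : 0 ≤ H.triangleSum S :=
  sum_nonneg fun _ _ => sum_nonneg fun _ _ => sum_nonneg fun _ _ =>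
    mul_nonneg (mul_nonneg (H.adjInd_nonneg _ _) (H.adjInd_nonneg _ _)) (H.adjInd_nonneg _ _)

lemma edgeSum_univ [Fintype V] (H : SimpleGraph V) [DecidableRel H.Adj] :
    H.edgeSum univ = 2 * #H.edgeFinset := by
  have h := H.sum_degrees_eq_twice_card_edges
  have h' : (∑ v, (H.degree v : ℤ)) = 2 * #H.edgeFinset := by exact_mod_cast h
  rw [← h', edgeSum]
  refine sum_congr rfl fun u _ => ?_
  rw [← card_neighborFinset_eq_degree, neighborFinset_eq_filter, card_filter]
  push_cast
  exact sum_congr rfl fun v _ => by simp [adjInd]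

lemma triangleSum_univ_le [Fintype V] [DecidableEq V] (H : SimpleGraph V) [DecidableRel H.Adj] :
    H.triangleSum univ ≤ 6 * #(H.cliqueFinset 3) := by
  let T : Finset (V × V × V) :=
    univ.filter fun p => H.Adj p.1 p.2.1 ∧ H.Adj p.2.1 p.2.2 ∧ H.Adj p.1 p.2.2
  have hT : H.triangleSum univ = #T := by
    simp only [T, card_filter, Nat.cast_sum, Fintype.sum_prod_type, triangleSum, adjInd]
    refine sum_congr rfl fun u _ => sum_congr rfl fun v _ => sum_congr rfl fun w _ => ?_
    by_cases h1 : H.Adj u v <;> by_cases h2 : H.Adj v w <;> by_cases h3 : H.Adj u w <;>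
      simp [h1, h2, h3]
  have hle : #T ≤ 6 * #(H.cliqueFinset 3) := by
    refine card_le_mul_card_image_of_maps_to (f := fun p => {p.1, p.2.1, p.2.2}) ?_ 6 ?_
    · rintro ⟨u, v, w⟩ h
      simp only [T, mem_filter, mem_univ, true_and] at h
      simp only [mem_cliqueFinset_iff, is3Clique_triple_iff]
      exact ⟨h.1, h.2.2, h.2.1⟩
    · intro s hs
      obtain ⟨a, b, c, -, -, -, rfl⟩ := is3Clique_iff.1 (mem_cliqueFinset_iff.1 hs)
      refine (card_le_card (t := {(a, b, c), (a, c, b), (b, a, c), (b, c, a), (c, a, b),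
        (c, b, a)}) ?_).trans card_le_six
      rintro ⟨u, v, w⟩ h
      simp only [T, mem_filter, mem_univ, true_and] at h
      obtain ⟨⟨huv, hvw, huw⟩, h⟩ := h
      have hu : u ∈ ({a, b, c} : Finset V) := h ▸ by simp
      have hv : v ∈ ({a, b, c} : Finset V) := h ▸ by simp
      have hw : w ∈ ({a, b, c} : Finset V) := h ▸ by simp
      have huv := huv.ne
      have hvw := hvw.ne
      have huw := huw.ne
      simp only [mem_insert, mem_singleton, Prod.mk.injEq] at hu hv hw ⊢
      grind
  rw [hT]
  exact_mod_cast hle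

end Counting

section ReplaceNeighbors

variable {V : Type*}

/-- Turn `W` into an independent set all of whose vertices have neighborhood `N \ W`. -/
def replaceNeighbors (H : SimpleGraph V) (W N : Finset V) : SimpleGraph V where
  Adj u v := (u ∉ W ∧ v ∉ W ∧ H.Adj u v) ∨ (u ∈ W ∧ v ∈ N ∧ v ∉ W) ∨ (v ∈ W ∧ u ∈ N ∧ u ∉ W)
  symm := ⟨fun u v h => by have := H.adj_comm u v; tauto⟩
  loopless := ⟨fun u h => by have := H.irrefl (v := u); tauto⟩

lemma replaceNeighbors_adj {H : SimpleGraph V} {W N : Finset V} {u v : V} :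
    (H.replaceNeighbors W N).Adj u v ↔
      (u ∉ W ∧ v ∉ W ∧ H.Adj u v) ∨ (u ∈ W ∧ v ∈ N ∧ v ∉ W) ∨ (v ∈ W ∧ u ∈ N ∧ u ∉ W) :=
  Iff.rfl

lemma adjInd_replaceNeighbors [DecidableEq V] (H : SimpleGraph V) (W N : Finset V) (u v : V) :
    (H.replaceNeighbors W N).adjInd u v =
      if u ∈ W then if v ∈ N \ W then 1 else 0
      else if v ∈ W then if u ∈ N \ W then 1 else 0 else H.adjInd u v := by
  have h := replaceNeighbors_adj (H := H) (W := W) (N := N) (u := u) (v := v)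
  by_cases hadj : (H.replaceNeighbors W N).Adj u v
  · rw [adjInd_of_adj hadj]
    have h' : H.Adj u v → H.adjInd u v = 1 := adjInd_of_adj
    grind
  · rw [adjInd_of_not_adj hadj]
    have h' : ¬ H.Adj u v → H.adjInd u v = 0 := adjInd_of_not_adj
    grind

lemma replaceNeighbors_self {H : SimpleGraph V} {W N : Finset V}
    (hN : ∀ w ∈ W, ∀ v, H.Adj w v ↔ v ∈ N) (hd : Disjoint W N) : H.replaceNeighbors W N = H := by
  ext u v
  rw [replaceNeighbors_adj]
  have h1 := hN u
  have h2 := hN v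
  have h3 := H.adj_comm u v
  have hu : u ∈ W → u ∉ N := fun h => Finset.disjoint_left.1 hd h
  have hv : v ∈ W → v ∉ N := fun h => Finset.disjoint_left.1 hd h
  grind

variable [Fintype V] [DecidableEq V]

lemma edgeSum_replaceNeighbors (H : SimpleGraph V) {W N : Finset V} (hd : Disjoint W N) :
    (H.replaceNeighbors W N).edgeSum univ = H.edgeSum Wᶜ + 2 * (#W * #N) := by
  have key : ∀ u v, (H.replaceNeighbors W N).adjInd u v =
      (if u ∈ Wᶜ then if v ∈ Wᶜ then H.adjInd u v else 0 else 0)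
      + (if u ∈ W then if v ∈ N then 1 else 0 else 0)
      + (if u ∈ N then if v ∈ W then 1 else 0 else 0) := by
    intro u v
    have hu : u ∈ W → u ∉ N := fun h => Finset.disjoint_left.1 hd h
    have hv : v ∈ W → v ∉ N := fun h => Finset.disjoint_left.1 hd h
    simp only [adjInd_replaceNeighbors, mem_compl, mem_sdiff]
    by_cases u ∈ W <;> by_cases v ∈ W <;> by_cases u ∈ N <;> by_cases v ∈ N <;> simp_all
  have h0 : ∀ (S : Finset V) (p : Prop) [Decidable p] (f : V → ℤ),
      ∑ v ∈ S, (if p then f v else 0) = if p then ∑ v ∈ S, f v else 0 := by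
    intro S p _ f; split_ifs <;> simp
  simp only [edgeSum, key, sum_add_distrib, h0, sum_ite_mem, univ_inter]
  simp
  ring

lemma triangleSum_replaceNeighbors (H : SimpleGraph V) {W N : Finset V} (hd : Disjoint W N) :
    (H.replaceNeighbors W N).triangleSum univ = H.triangleSum Wᶜ + 3 * (#W * H.edgeSum N) := by
  have key : ∀ u v w, (H.replaceNeighbors W N).adjInd u v * (H.replaceNeighbors W N).adjInd v w *
        (H.replaceNeighbors W N).adjInd u w =
      (if u ∈ Wᶜ then if v ∈ Wᶜ then if w ∈ Wᶜ then
        H.adjInd u v * H.adjInd v w * H.adjInd u w else 0 else 0 else 0)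
      + (if u ∈ W then if v ∈ N then if w ∈ N then H.adjInd v w else 0 else 0 else 0)
      + (if u ∈ N then if v ∈ W then if w ∈ N then H.adjInd u w else 0 else 0 else 0)
      + (if u ∈ N then if v ∈ N then if w ∈ W then H.adjInd u v else 0 else 0 else 0) := by
    intro u v w
    have hu : u ∈ W → u ∉ N := fun h => Finset.disjoint_left.1 hd h
    have hv : v ∈ W → v ∉ N := fun h => Finset.disjoint_left.1 hd h
    have hw : w ∈ W → w ∉ N := fun h => Finset.disjoint_left.1 hd h
    simp only [adjInd_replaceNeighbors, mem_compl, mem_sdiff]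
    by_cases u ∈ W <;> by_cases v ∈ W <;> by_cases w ∈ W <;> by_cases u ∈ N <;>
      by_cases v ∈ N <;> by_cases w ∈ N <;> simp_all
  have h0 : ∀ (S : Finset V) (p : Prop) [Decidable p] (f : V → ℤ),
      ∑ v ∈ S, (if p then f v else 0) = if p then ∑ v ∈ S, f v else 0 := by
    intro S p _ f; split_ifs <;> simp
  simp only [triangleSum, edgeSum, key, sum_add_distrib, h0, sum_ite_mem, univ_inter]
  simp only [sum_const, nsmul_eq_mul, ← mul_sum]
  ring

/-- Six times the difference of the number of triangles and `r` times the number of edges. -/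
noncomputable def triangleDefect (r : ℤ) (H : SimpleGraph V) : ℤ :=
  H.triangleSum univ - 3 * r * H.edgeSum univ

lemma triangleDefect_replaceNeighbors (r : ℤ) (H : SimpleGraph V) {W N : Finset V}
    (hd : Disjoint W N) :
    triangleDefect r (H.replaceNeighbors W N) =
      H.triangleSum Wᶜ - 3 * r * H.edgeSum Wᶜ + 3 * #W * (H.edgeSum N - 2 * r * #N) := by
  rw [triangleDefect, edgeSum_replaceNeighbors H hd, triangleSum_replaceNeighbors H hd]
  ring

end ReplaceNeighbors

section CliqueBounded

variable {V : Type*}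

/-- A clique whose vertices all have `σ`-value at most `l` has at most `l` vertices. -/
def CliqueBounded (σ : V → ℕ) (H : SimpleGraph V) : Prop :=
  ∀ (l : ℕ) (Q : Finset V), (∀ v ∈ Q, σ v ≤ l) → H.IsClique Q → #Q ≤ l

lemma CliqueBounded.card_lt_of_adj {σ : V → ℕ} {H : SimpleGraph V} (hH : CliqueBounded σ H)
    {l : ℕ} {Q : Finset V} {x : V} (hσ : ∀ v ∈ Q, σ v ≤ l) (hQ : H.IsClique Q) (hx : σ x ≤ l)
    (hadj : ∀ v ∈ Q, H.Adj x v) : #Q < l := by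
  classical
  have hxQ : x ∉ Q := fun h => H.irrefl (hadj x h)
  rw [Nat.lt_iff_add_one_le, ← card_insert_of_notMem hxQ]
  refine hH l _ ?_ ?_
  · simpa [hx] using hσ
  · rw [coe_insert, isClique_insert]
    exact ⟨hQ, fun v hv _ => hadj v hv⟩

lemma CliqueBounded.replaceNeighbors {σ : V → ℕ} {H : SimpleGraph V} (hH : CliqueBounded σ H)
    {W N : Finset V}
    (hN : ∀ (l : ℕ) (Q : Finset V), Q ⊆ N → (∀ v ∈ Q, σ v ≤ l) → H.IsClique Q →
      ∀ x ∈ W, σ x ≤ l → #Q < l) :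
    CliqueBounded σ (H.replaceNeighbors W N) := by
  classical
  intro l Q hσ hQ
  by_cases hW : ∃ x ∈ Q, x ∈ W
  · obtain ⟨x, hxQ, hxW⟩ := hW
    have hx : ∀ v ∈ Q, v ≠ x → v ∈ N ∧ v ∉ W := fun v hv hvx => by
      have := replaceNeighbors_adj.1 (hQ hxQ hv hvx.symm)
      tauto
    rw [← card_erase_add_one hxQ]
    refine hN l (Q.erase x) ?_ ?_ ?_ x hxW (hσ x hxQ)
    · intro v hv
      exact (hx v (mem_of_mem_erase hv) (ne_of_mem_erase hv)).1
    · exact fun v hv => hσ v (mem_of_mem_erase hv)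
    · intro u hu v hv huv
      rw [mem_coe, mem_erase] at hu hv
      have h1 := (hx u hu.2 hu.1).2
      have h2 := (hx v hv.2 hv.1).2
      have := replaceNeighbors_adj.1 (hQ hu.2 hv.2 huv)
      tauto
  · push Not at hW
    refine hH l Q hσ fun u hu v hv huv => ?_
    have h1 := hW u hu
    have h2 := hW v hv
    have := replaceNeighbors_adj.1 (hQ hu hv huv)
    tauto

/-- `W` is a set of twins containing `w₀` and meeting every member of `P` that is not a clique,
in a graph whose cliques are bounded by `σ`. -/
structure IsTwinConfig (σ : V → ℕ) (P : Finset (Finset V)) (w₀ : V) (H : SimpleGraph V)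
    (W : Finset V) : Prop where
  cliqueBounded : CliqueBounded σ H
  mem : w₀ ∈ W
  adj_iff : ∀ w ∈ W, ∀ v, H.Adj w v ↔ H.Adj w₀ v
  isClique_or : ∀ D ∈ P, H.IsClique D ∨ ∃ v ∈ D, v ∈ W

lemma IsTwinConfig.not_adj {σ : V → ℕ} {P : Finset (Finset V)} {w₀ : V} {H : SimpleGraph V}
    {W : Finset V} (h : IsTwinConfig σ P w₀ H W) {w : V} (hw : w ∈ W) : ¬ H.Adj w₀ w :=
  fun hadj => H.irrefl ((h.adj_iff w hw w).2 hadj)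

end CliqueBounded

section Symmetrization

variable {V : Type*} [Fintype V] [DecidableEq V]

open Classical in
/-- A twin class that misses a non-neighbor `y` of `w₀` can be improved: either `y` becomes a twin
of `w₀`, or all the twins of `w₀` become twins of `y`. -/
lemma IsTwinConfig.exists_improvement {σ : V → ℕ} {P : Finset (Finset V)} {w₀ : V}
    {H : SimpleGraph V} {W : Finset V} (h : IsTwinConfig σ P w₀ H W) (hmin : ∀ v, σ w₀ ≤ σ v)
    (r : ℤ) (hy : ∃ y ∉ W, ¬ H.Adj w₀ y) :
    ∃ H' W', IsTwinConfig σ P w₀ H' W' ∧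
      (triangleDefect r H' ≤ triangleDefect r H ∧ #W < #W' ∨
        triangleDefect r H' < triangleDefect r H ∧ #W ≤ #W') := by
  obtain ⟨y, ⟨hyW, hyadj⟩, hymin⟩ : ∃ y, (y ∉ W ∧ ¬ H.Adj w₀ y) ∧
      ∀ v, v ∉ W ∧ ¬ H.Adj w₀ v → σ y ≤ σ v := by
    obtain ⟨y, hy, hy'⟩ := exists_min_image (univ.filter fun y => y ∉ W ∧ ¬ H.Adj w₀ y) σ
      (by simpa [Finset.Nonempty] using hy)
    exact ⟨y, by simpa using hy, fun v hv => hy' v (by simpa using hv)⟩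
  have hywn : ∀ w ∈ W, ¬ H.Adj y w := fun w hw hadj => hyadj ((h.adj_iff w hw y).1 hadj.symm)
  have hdW₀ : Disjoint W (H.neighborFinset w₀) :=
    Finset.disjoint_left.2 fun w hw => by simpa using h.not_adj hw
  have hdWy : Disjoint W (H.neighborFinset y) :=
    Finset.disjoint_left.2 fun w hw => by simpa using hywn w hw
  have hdy₀ : Disjoint {y} (H.neighborFinset w₀) := by simpa using hyadj
  have hdyy : Disjoint {y} (H.neighborFinset y) := by simp
  have hH₀ := triangleDefect_replaceNeighbors r H hdW₀
  rw [replaceNeighbors_self (by simpa using h.adj_iff) hdW₀] at hH₀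
  have hHy := triangleDefect_replaceNeighbors r H hdyy
  rw [replaceNeighbors_self (by simp) hdyy] at hHy
  by_cases hcmp : H.edgeSum (H.neighborFinset w₀) - 2 * r * #(H.neighborFinset w₀) ≤
      H.edgeSum (H.neighborFinset y) - 2 * r * #(H.neighborFinset y)
  · refine ⟨H.replaceNeighbors {y} (H.neighborFinset w₀), insert y W,
      ⟨?_, mem_insert_of_mem h.mem, ?_, ?_⟩, Or.inl ⟨?_, ?_⟩⟩
    · refine h.cliqueBounded.replaceNeighbors fun l Q hQN hσ hQ x hx hxl => ?_
      exact h.cliqueBounded.card_lt_of_adj hσ hQ ((hmin x).trans hxl)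
        fun v hv => by simpa using hQN hv
    · have hne : w₀ ≠ y := fun e => hyW (e ▸ h.mem)
      intro w hw v
      rw [mem_insert] at hw
      simp only [replaceNeighbors_adj, mem_singleton, mem_neighborFinset, H.irrefl]
      rcases hw with rfl | hw
      · have : v = w → ¬ H.Adj w₀ v := by rintro rfl; exact hyadj
        grind
      · have := h.adj_iff w hw v
        have := h.not_adj hw
        grind
    · intro D hD
      by_cases hyD : y ∈ D
      · exact Or.inr ⟨y, hyD, mem_insert_self _ _⟩
      rcases h.isClique_or D hD with hc | ⟨v, hv, hvW⟩
      · refine Or.inl fun u hu v hv huv => replaceNeighbors_adj.2 (Or.inl ⟨?_, ?_, hc hu hv huv⟩)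
        · rw [mem_singleton]; rintro rfl; exact hyD hu
        · rw [mem_singleton]; rintro rfl; exact hyD hv
      · exact Or.inr ⟨v, hv, mem_insert_of_mem hvW⟩
    · rw [triangleDefect_replaceNeighbors r H hdy₀, hHy]
      simp only [card_singleton, Nat.cast_one]
      linarith
    · rw [card_insert_of_notMem hyW]; exact Nat.lt_succ_self _
  · refine ⟨H.replaceNeighbors W (H.neighborFinset y), W, ⟨?_, h.mem, ?_, ?_⟩, Or.inr ⟨?_, le_rfl⟩⟩
    · refine h.cliqueBounded.replaceNeighbors fun l Q hQN hσ hQ x hx hxl => ?_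
      by_cases hyl : σ y ≤ l
      · exact h.cliqueBounded.card_lt_of_adj hσ hQ hyl fun v hv => by simpa using hQN hv
      · refine h.cliqueBounded.card_lt_of_adj hσ hQ ((hmin x).trans hxl) fun v hv => ?_
        by_contra hv'
        have := hymin v ⟨Finset.disjoint_right.1 hdWy (hQN hv), hv'⟩
        have := hσ v hv
        omega
    · intro w hw v
      have := h.mem
      simp only [replaceNeighbors_adj]
      tauto
    · intro D hD
      by_cases hDW : ∃ v ∈ D, v ∈ W
      · exact Or.inr hDW
      · have hc := (h.isClique_or D hD).resolve_right hDW
        push Not at hDW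
        exact Or.inl fun u hu v hv huv =>
          replaceNeighbors_adj.2 (Or.inl ⟨hDW u hu, hDW v hv, hc hu hv huv⟩)
    · rw [triangleDefect_replaceNeighbors r H hdWy, hH₀]
      have hpos : (0 : ℤ) < #W := by exact_mod_cast card_pos.2 ⟨w₀, h.mem⟩
      have := mul_lt_mul_of_pos_left (not_le.1 hcmp) hpos
      linarith

/-- Among the twin configurations with smallest defect, one of largest twin class has the twin
class equal to the set of all non-neighbors of `w₀`. -/
lemma IsTwinConfig.exists_complete {σ : V → ℕ} {P : Finset (Finset V)} {w₀ : V}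
    {G : SimpleGraph V} {W₀ : Finset V} (hG : IsTwinConfig σ P w₀ G W₀)
    (hmin : ∀ v, σ w₀ ≤ σ v) (r : ℤ) :
    ∃ H W, IsTwinConfig σ P w₀ H W ∧ triangleDefect r H ≤ triangleDefect r G ∧
      ∀ y, ¬ H.Adj w₀ y → y ∈ W := by
  obtain ⟨⟨H, W⟩, hHW, hopt⟩ := Set.exists_min_image
    {p : SimpleGraph V × Finset V | IsTwinConfig σ P w₀ p.1 p.2}
    (fun p => toLex (triangleDefect r p.1, -(#p.2 : ℤ))) (Set.toFinite _) ⟨(G, W₀), hG⟩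
  change IsTwinConfig σ P w₀ H W at hHW
  refine ⟨H, W, hHW, ?_, ?_⟩
  · have := hopt (G, W₀) hG
    rw [Prod.Lex.toLex_le_toLex] at this
    rcases this with h | h
    · exact h.le
    · exact h.1.le
  · by_contra! hy
    obtain ⟨H', W', h', himp⟩ := hHW.exists_improvement hmin r
      (hy.imp fun y hy => ⟨hy.2, hy.1⟩)
    have : triangleDefect r H < triangleDefect r H' ∨
        triangleDefect r H = triangleDefect r H' ∧ -(#W : ℤ) ≤ -(#W' : ℤ) :=
      Prod.Lex.toLex_le_toLex.1 (hopt (H', W') h')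
    omega

end Symmetrization

end SimpleGraph

open SimpleGraph

/-- If `G` is a graph on `n` vertices with `e` edges and `t`
triangles and `P` is a greedy partition of `G` of size `r`, then
`t ≥ r·(e − n²/4)`, i.e. as integers `4t ≥ r·(4e − n²)`. -/
theorem triangles_ge_greedy_size_mul_excess
    {V : Type*} [Fintype V] [DecidableEq V]
    (G : SimpleGraph V) [DecidableRel G.Adj]
    (P : Finset (Finset V)) (hP : IsGreedyPartition G P) :
    (P.card : ℤ) * (4 * G.edgeFinset.card - (Fintype.card V : ℤ) ^ 2)
      ≤ 4 * (G.cliqueFinset 3).card := by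
  classical
  obtain ⟨hne, hclique, hpart, hgreedy⟩ := hP
  rcases P.eq_empty_or_nonempty with rfl | hPne
  · simp
  choose part hpart huniq using hpart
  have hpart_eq : ∀ C ∈ P, ∀ v ∈ C, part v = C := fun C hC v hv => (huniq v C ⟨hC, hv⟩).symm
  obtain ⟨M, hM, hMmin⟩ := exists_min_image P Finset.card hPne
  obtain ⟨w₀, hw₀⟩ := hne M hM
  let σ : V → ℕ := fun v => #(part v)
  have hmin : ∀ v, σ w₀ ≤ σ v := fun v => by
    simpa [σ, hpart_eq M hM w₀ hw₀] using hMmin (part v) (hpart v).1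
  have hG : IsTwinConfig σ P w₀ G {w₀} := by
    refine ⟨fun l Q hσ hQ => ?_, mem_singleton_self _, by simp, fun D hD => Or.inl (hclique D hD)⟩
    by_contra! hlt
    obtain ⟨s, hsQ, hs⟩ := exists_subset_card_eq (Nat.succ_le_of_lt hlt)
    obtain ⟨v, hv⟩ : s.Nonempty := card_pos.1 (by omega)
    have hl : 1 ≤ l := (card_pos.2 ⟨v, (hpart v).2⟩).trans_le (hσ v (hsQ hv))
    exact hgreedy l hl s (fun u hu => ⟨part u, (hpart u).1, (hpart u).2, hσ u (hsQ hu)⟩)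
      ⟨hQ.subset (coe_subset.2 hsQ), hs⟩
  obtain ⟨H, W, hHW, hle, hW⟩ := hG.exists_complete hmin (#P : ℤ)
  have hmeet : ∀ D ∈ P, ∃ v ∈ D, v ∈ W := by
    intro D hD
    by_contra! hDW
    have hc := (hHW.isClique_or D hD).resolve_right (by simpa using hDW)
    refine lt_irrefl #D (hHW.cliqueBounded.card_lt_of_adj (x := w₀) (fun v hv => ?_) hc ?_ ?_)
    · simp [σ, hpart_eq D hD v hv]
    · simpa [σ, hpart_eq M hM w₀ hw₀] using hMmin D hD
    · exact fun v hv => by_contra fun hadj => hDW v hv (hW v hadj)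
  have hcard : #P ≤ #W := by
    refine (card_le_card fun D hD => ?_).trans (card_image_le (f := part))
    obtain ⟨v, hvD, hvW⟩ := hmeet D hD
    exact mem_image.2 ⟨v, hvW, hpart_eq D hD v hvD⟩
  have hN : ∀ w ∈ W, ∀ v, H.Adj w v ↔ v ∈ Wᶜ := by
    intro w hw v
    rw [hHW.adj_iff w hw, mem_compl]
    exact ⟨fun hadj hv => hHW.not_adj hv hadj, fun hv => by_contra fun hadj => hv (hW v hadj)⟩
  have hdefect := triangleDefect_replaceNeighbors (#P : ℤ) H (disjoint_compl_right (a := W))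
  rw [replaceNeighbors_self hN disjoint_compl_right] at hdefect
  have hn : (Fintype.card V : ℤ) = #W + #Wᶜ := by exact_mod_cast (card_add_card_compl W).symm
  have ht := G.triangleSum_univ_le
  have hGdef : triangleDefect (#P : ℤ) G =
      G.triangleSum univ - 3 * #P * (2 * #G.edgeFinset) := by
    rw [triangleDefect, edgeSum_univ]
  have h1 := H.triangleSum_nonneg Wᶜ
  have h2 : 0 ≤ ((#W : ℤ) - #P) * H.edgeSum Wᶜ :=
    mul_nonneg (sub_nonneg.2 (by exact_mod_cast hcard)) (H.edgeSum_nonneg _)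
  have h3 : 0 ≤ (#P : ℤ) * ((#W : ℤ) - #Wᶜ) ^ 2 := by positivity
  rw [hn]
  linarith
end
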